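/- Let n ≥ 2 and let v : (0,∞) → [0,∞) be measurable with v(r) ≤ n ω_n r^{n-1} for H^1-a.e. r, such that F_v is a set of finite perimeter and finite volume. Suppose the set {0 < α_v^∧ ≤ α_v^∨ < π} is not an interval: there exists r̄ with α_v^∧(r̄) = 0 or α_v^∨(r̄) = π such that both (0,r̄) ∩ {0 < α_v^∧ ≤ α_v^∨ < π} and (r̄,∞) ∩ {0 < α_v^∧ ≤ α_v^∨ < π} are nonempty. Then, setting E₁ := F_v ∩ B(0,r̄) and E₂ := F_v \ B(0,r̄), the set E₁ ∪ (R E₂) is spherically v-distributed with P(E₁ ∪ (R E₂)) = P(F_v) for every R ∈ O(n); in particular rigidity fails. -/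

import Mathlib

/- Common definitions: geometric measure theory notions (density points, essential
boundary, perimeter, reduced boundary and measure-theoretic outer unit normal),
spherical and circular symmetrisation, BV and Sobolev-type notions. -/

open MeasureTheory Metric Set Filter
open scoped ENNReal NNReal Topology RealInnerProductSpace

noncomputable section

/-- Euclidean space `ℝⁿ`. -/
abbrev Euc (n : ℕ) : Type := EuclideanSpace ℝ (Fin n)

/-- `ω_k`: the volume of the unit ball of `ℝ^k`. -/
def omegaBall (k : ℕ) : ℝ := (volume (ball (0 : Euc k) 1)).toReal

/-- The radial unit vector `x̂ = x/|x|`. -/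
def hatv {n : ℕ} (x : Euc n) : Euc n := ‖x‖⁻¹ • x

/-- The first vector of the canonical basis. -/
def e1 (n : ℕ) (hn : 0 < n) : Euc n := EuclideanSpace.single ⟨0, hn⟩ 1

/-- `E` has `n`-dimensional density `t` at `x`. -/
def DensityAt {n : ℕ} (E : Set (Euc n)) (x : Euc n) (t : ℝ≥0∞) : Prop :=
  Tendsto (fun ρ : ℝ => volume (E ∩ ball x ρ) / volume (ball x ρ)) (𝓝[>] (0:ℝ)) (𝓝 t)

/-- The essential boundary `∂ᵉE`: points of density neither `0` nor `1`. -/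
def essBoundary {n : ℕ} (E : Set (Euc n)) : Set (Euc n) :=
  {x | ¬ DensityAt E x 0 ∧ ¬ DensityAt E x 1}

/-- The perimeter of `E` relative to `A`: `P(E;A) = H^{n-1}(∂ᵉE ∩ A)`. -/
def perim {n : ℕ} (E A : Set (Euc n)) : ℝ≥0∞ := μH[(n : ℝ) - 1] (essBoundary E ∩ A)

/-- `ν` is the measure-theoretic outer unit normal of `E` at `x`: the blow-up of `E`
at `x` is the half space `{y : (y-x)·ν ≤ 0}` in density. -/
def HasMTNormal {n : ℕ} (E : Set (Euc n)) (x ν : Euc n) : Prop :=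
  ‖ν‖ = 1 ∧
    Tendsto (fun ρ : ℝ =>
        volume ({y | y ∈ E ∧ 0 < ⟪y - x, ν⟫} ∩ ball x ρ) / volume (ball x ρ))
      (𝓝[>] (0:ℝ)) (𝓝 0) ∧
    Tendsto (fun ρ : ℝ =>
        volume ({y | y ∉ E ∧ ⟪y - x, ν⟫ < 0} ∩ ball x ρ) / volume (ball x ρ))
      (𝓝[>] (0:ℝ)) (𝓝 0)

/-- The reduced boundary `∂*E`. -/
def redBoundary {n : ℕ} (E : Set (Euc n)) : Set (Euc n) := {x | ∃ ν, HasMTNormal E x ν}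

/-- The measure-theoretic outer unit normal `ν^E`. -/
def mtNormal {n : ℕ} (E : Set (Euc n)) (x : Euc n) : Euc n :=
  haveI := Classical.propDecidable (∃ ν, HasMTNormal E x ν)
  if h : ∃ ν, HasMTNormal E x ν then h.choose else 0

/-- The tangential component `ν∥^E(x) = ν^E(x) - (ν^E(x)·x̂)x̂` of the normal along
the sphere `∂B(|x|)`. -/
def nuPar {n : ℕ} (E : Set (Euc n)) (x : Euc n) : Euc n :=
  mtNormal E x - ⟪mtNormal E x, hatv x⟫ • hatv x

/-- The open geodesic ball (spherical cap) `B_β(r p)` in the sphere `∂B(0,r)`. -/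
def capSet {n : ℕ} (p : Euc n) (r β : ℝ) : Set (Euc n) :=
  {x | x ∈ sphere (0 : Euc n) r ∧ Real.arccos ⟪hatv x, p⟫ < β}

/-- The geodesic sphere `S_β(r p)` in the sphere `∂B(0,r)`. -/
def capSphere {n : ℕ} (p : Euc n) (r β : ℝ) : Set (Euc n) :=
  {x | x ∈ sphere (0 : Euc n) r ∧ Real.arccos ⟪hatv x, p⟫ = β}

/-- `E ⊆ ℝⁿ` is spherically `v`-distributed: `H^{n-1}(E ∩ ∂B(0,r)) = v r` for a.e. `r > 0`. -/
def SphDistrib {n : ℕ} (v : ℝ → ℝ) (E : Set (Euc n)) : Prop :=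
  ∀ᵐ r ∂(volume.restrict (Ioi (0:ℝ))),
    μH[(n : ℝ) - 1] (E ∩ sphere (0 : Euc n) r) = ENNReal.ofReal (v r)

/-- The spherical symmetral `F_v` (determined by the angle function `α = α_v` and the
direction `p`). -/
def sphSymm (n : ℕ) (α : ℝ → ℝ) (p : Euc n) : Set (Euc n) :=
  {x : Euc n | x ≠ 0 ∧ Real.arccos ⟪hatv x, p⟫ < α ‖x‖}

/-- `Φ(B × S^{n-1})`, for `B ⊆ (0,∞)`. -/
def sphShell (n : ℕ) (B : Set ℝ) : Set (Euc n) := {x : Euc n | x ≠ 0 ∧ ‖x‖ ∈ B}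

/-- `v ∈ BV(0,∞)`: `v` is integrable on `(0,∞)` and has a representative of bounded
pointwise variation there. -/
def BVIoi (v : ℝ → ℝ) : Prop :=
  IntegrableOn v (Ioi (0:ℝ)) volume ∧
    ∃ w : ℝ → ℝ, (∀ᵐ r ∂(volume.restrict (Ioi (0:ℝ))), w r = v r) ∧
      BoundedVariationOn w (Ioi (0:ℝ))

/-- `f ∈ W^{1,1}_loc(I)` for `I ⊆ ℝ`: `f` has a representative `w` which is locally
absolutely continuous on `I`, i.e. `w b - w a = ∫_a^b g` with `g` locally integrable on `I`. -/
def W11locOn (f : ℝ → ℝ) (I : Set ℝ) : Prop :=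
  ∃ w g : ℝ → ℝ, (∀ᵐ r ∂(volume.restrict I), w r = f r) ∧
    LocallyIntegrableOn g I volume ∧
    ∀ a b : ℝ, uIcc a b ⊆ I → w b - w a = ∫ t in a..b, g t

/-- `S ⊆ ℝ` has one-dimensional density `0` at `x`. -/
def RDensity0 (S : Set ℝ) (x : ℝ) : Prop :=
  Tendsto (fun ρ : ℝ => volume (S ∩ ball x ρ) / volume (ball x ρ)) (𝓝[>] (0:ℝ)) (𝓝 0)

/-- The approximate upper limit `f^∨(x)` (for bounded `f`). -/
def apSup (f : ℝ → ℝ) (x : ℝ) : ℝ := sInf {t : ℝ | RDensity0 {y | t < f y} x}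

/-- The approximate lower limit `f^∧(x)` (for bounded `f`). -/
def apInf (f : ℝ → ℝ) (x : ℝ) : ℝ := sSup {t : ℝ | RDensity0 {y | f y < t} x}

/-- `t` is the approximate limit of `f` at `x` with respect to `A`. -/
def apLimOn (f : ℝ → ℝ) (A : Set ℝ) (x t : ℝ) : Prop :=
  ∀ ε : ℝ, 0 < ε → RDensity0 ({y | ε < |f y - t|} ∩ A) x

/-- Density (with value `t`) at `x` of a subset `A` of the sphere `∂B(0,r)`,
with respect to the measure `H^{n-1}` on the sphere. -/
def SphDensityAt {n : ℕ} (A : Set (Euc n)) (r : ℝ) (x : Euc n) (t : ℝ≥0∞) : Prop :=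
  Tendsto (fun ρ : ℝ =>
      μH[(n : ℝ) - 1] (A ∩ ball x ρ) / μH[(n : ℝ) - 1] (sphere (0 : Euc n) r ∩ ball x ρ))
    (𝓝[>] (0:ℝ)) (𝓝 t)

/-- The essential boundary, within the sphere `∂B(0,r)`, of a subset `A` of that sphere. -/
def sphEssBoundary {n : ℕ} (A : Set (Euc n)) (r : ℝ) : Set (Euc n) :=
  {x | x ∈ sphere (0 : Euc n) r ∧ ¬ SphDensityAt A r x 0 ∧ ¬ SphDensityAt A r x 1}

/-- A pair of mutually singular measures `(σp, σm)` supported in `(0,∞)`, locally finite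
there, representing the distributional derivative `Dξ = σp - σm` of `ξ` on `(0,∞)`. -/
def RepDeriv (ξ : ℝ → ℝ) (σp σm : Measure ℝ) : Prop :=
  σp (Iic (0:ℝ)) = 0 ∧ σm (Iic (0:ℝ)) = 0 ∧
    (∀ K : Set ℝ, K ⊆ Ioi (0:ℝ) → IsCompact K → σp K < ⊤ ∧ σm K < ⊤) ∧
    σp.MutuallySingular σm ∧
    ∀ φ : ℝ → ℝ, ContDiff ℝ 1 φ → HasCompactSupport φ → tsupport φ ⊆ Ioi (0:ℝ) →
      (∫ r in Ioi (0:ℝ), ξ r * deriv φ r) = (∫ r, φ r ∂σm) - ∫ r, φ r ∂σp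

/-- The density `ξ'` of the absolutely continuous part of `Dξ = σp - σm`. -/
def acDeriv (σp σm : Measure ℝ) (r : ℝ) : ℝ :=
  (σp.rnDeriv volume r).toReal - (σm.rnDeriv volume r).toReal

/-- `p_E(r) = H^{n-2}(∂*E ∩ ∂B(0,r))` (as a real number). -/
def pSlice {n : ℕ} (E : Set (Euc n)) (r : ℝ) : ℝ :=
  (μH[(n : ℝ) - 2] (redBoundary E ∩ sphere (0 : Euc n) r)).toReal

/-- The projection `x ↦ x₁₂` onto the plane of the first two coordinates. -/
def pr12 {n : ℕ} (hn : 2 ≤ n) (x : Euc n) : Euc 2 :=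
  (EuclideanSpace.equiv (Fin 2) ℝ).symm fun i => x ⟨i.1, lt_of_lt_of_le i.2 hn⟩

/-- The projection `x ↦ x'` onto the remaining `n - 2` coordinates. -/
def prC {n : ℕ} (hn : 2 ≤ n) (x : Euc n) : Euc (n - 2) :=
  (EuclideanSpace.equiv (Fin (n - 2)) ℝ).symm fun i => x ⟨i.1 + 2, by have := i.2; omega⟩

/-- The circle `∂B((0,x'),r) ∩ Π_{x'}`, for `p = (r, x')`. -/
def circFiber {n : ℕ} (hn : 2 ≤ n) (p : ℝ × Euc (n - 2)) : Set (Euc n) :=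
  {y : Euc n | prC hn y = p.2 ∧ ‖pr12 hn y‖ = p.1}

/-- The circular slice `E_{(r,x')}`, for `p = (r, x')`. -/
def cslice {n : ℕ} (hn : 2 ≤ n) (E : Set (Euc n)) (p : ℝ × Euc (n - 2)) : Set (Euc n) :=
  E ∩ circFiber hn p

/-- `E` is circularly `ℓ`-distributed. -/
def CircDistrib {n : ℕ} (hn : 2 ≤ n) (ℓ : ℝ × Euc (n - 2) → ℝ) (E : Set (Euc n)) : Prop :=
  ∀ᵐ p ∂(volume.restrict ((Ioi (0:ℝ)) ×ˢ (univ : Set (Euc (n - 2))))),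
    μH[(1:ℝ)] (cslice hn E p) = ENNReal.ofReal (ℓ p)

/-- The circular symmetral `F^ℓ`. -/
def circSymm {n : ℕ} (hn : 2 ≤ n) (ℓ : ℝ × Euc (n - 2) → ℝ) : Set (Euc n) :=
  {x : Euc n | pr12 hn x ≠ 0 ∧
    Real.arccos ⟪hatv (pr12 hn x), e1 2 (by norm_num)⟫
      < ℓ (‖pr12 hn x‖, prC hn x) / (2 * ‖pr12 hn x‖)}

/-- `Φ₁₂(B × S¹)`, for `B ⊆ (0,∞) × ℝ^{n-2}`. -/
def cylSet {n : ℕ} (hn : 2 ≤ n) (B : Set (ℝ × Euc (n - 2))) : Set (Euc n) :=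
  {x : Euc n | pr12 hn x ≠ 0 ∧ (‖pr12 hn x‖, prC hn x) ∈ B}

/-- The component `ν₁₂∥^E(x) = ν₁₂^E(x) - (ν^E(x)·x̂₁₂)x̂₁₂` of the normal. -/
def nu12par {n : ℕ} (hn : 2 ≤ n) (E : Set (Euc n)) (x : Euc n) : Euc 2 :=
  pr12 hn (mtNormal E x) - ⟪pr12 hn (mtNormal E x), hatv (pr12 hn x)⟫ • hatv (pr12 hn x)

/-- Density (with value `t`) at `x` of a subset `A` of the circle `circFiber hn p`,
with respect to the measure `H¹` on that circle. -/
def CircDensityAt {n : ℕ} (hn : 2 ≤ n) (A : Set (Euc n)) (p : ℝ × Euc (n - 2)) (x : Euc n)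
    (t : ℝ≥0∞) : Prop :=
  Tendsto (fun ρ : ℝ => μH[(1:ℝ)] (A ∩ ball x ρ) / μH[(1:ℝ)] (circFiber hn p ∩ ball x ρ))
    (𝓝[>] (0:ℝ)) (𝓝 t)

/-- The essential boundary, within the circle `circFiber hn p`, of a subset `A`. -/
def circEssBoundary {n : ℕ} (hn : 2 ≤ n) (A : Set (Euc n)) (p : ℝ × Euc (n - 2)) :
    Set (Euc n) :=
  {x | x ∈ circFiber hn p ∧ ¬ CircDensityAt hn A p x 0 ∧ ¬ CircDensityAt hn A p x 1}

/-- `f` has locally bounded variation on the open set `Ω`: on every open `U` compactly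
contained in `Ω` the distributional gradient of `f` has finite total variation. -/
def BVlocOn {W : Type*} [NormedAddCommGroup W] [NormedSpace ℝ W] [MeasureSpace W]
    (f : W → ℝ) (Ω : Set W) : Prop :=
  LocallyIntegrableOn f Ω volume ∧
    ∀ U : Set W, IsOpen U → IsCompact (closure U) → closure U ⊆ Ω →
      ∃ C : ℝ, ∀ g : W → W, ContDiff ℝ 1 g → HasCompactSupport g → tsupport g ⊆ U →
        (∀ x, ‖g x‖ ≤ 1) →
        (∫ x in U, f x * LinearMap.trace ℝ W (fderiv ℝ g x).toLinearMap) ≤ C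

/-- `f ∈ W^{1,1}_loc(Ω)` for `Ω ⊆ (0,∞) × ℝ^m`: `f` has a locally integrable weak
gradient `(g1, g2)` on `Ω`. -/
def W11locProd {m : ℕ} (f : ℝ × Euc m → ℝ) (Ω : Set (ℝ × Euc m)) : Prop :=
  ∃ (g1 : ℝ × Euc m → ℝ) (g2 : ℝ × Euc m → Euc m),
    LocallyIntegrableOn f Ω volume ∧ LocallyIntegrableOn g1 Ω volume ∧
      LocallyIntegrableOn g2 Ω volume ∧
      ∀ φ : ℝ × Euc m → ℝ, ContDiff ℝ 1 φ → HasCompactSupport φ → tsupport φ ⊆ Ω →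
        ∀ y : ℝ × Euc m,
          (∫ x in Ω, f x * fderiv ℝ φ x y) = -∫ x in Ω, φ x * (g1 x * y.1 + ⟪g2 x, y.2⟫)

/-- A pair of mutually singular measures `(σp, σm)` supported in `Ω₀ = (0,∞) × ℝ^m`,
locally finite there, representing the partial distributional derivative
`D_r ξ = σp - σm` of `ξ` in the radial variable. -/
def RepDerivR {m : ℕ} (ξ : ℝ × Euc m → ℝ) (σp σm : Measure (ℝ × Euc m)) : Prop :=
  σp ((Ioi (0:ℝ)) ×ˢ (univ : Set (Euc m)))ᶜ = 0 ∧
    σm ((Ioi (0:ℝ)) ×ˢ (univ : Set (Euc m)))ᶜ = 0 ∧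
    (∀ K : Set (ℝ × Euc m), K ⊆ (Ioi (0:ℝ)) ×ˢ univ → IsCompact K → σp K < ⊤ ∧ σm K < ⊤) ∧
    σp.MutuallySingular σm ∧
    ∀ φ : ℝ × Euc m → ℝ, ContDiff ℝ 1 φ → HasCompactSupport φ →
      tsupport φ ⊆ (Ioi (0:ℝ)) ×ˢ (univ : Set (Euc m)) →
      (∫ x in (Ioi (0:ℝ)) ×ˢ (univ : Set (Euc m)), ξ x * fderiv ℝ φ x ((1:ℝ), (0 : Euc m)))
        = (∫ x, φ x ∂σm) - ∫ x, φ x ∂σp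

/-- A polar representation `(τ, h)` (with `‖h‖ = 1` `τ`-a.e.) of the distributional
gradient `D_{x'} f = h τ` of `f` in the `x'` variables, on `Ω₀ = (0,∞) × ℝ^m`. -/
def RepDerivX {m : ℕ} (f : ℝ × Euc m → ℝ) (τ : Measure (ℝ × Euc m))
    (h : ℝ × Euc m → Euc m) : Prop :=
  τ ((Ioi (0:ℝ)) ×ˢ (univ : Set (Euc m)))ᶜ = 0 ∧
    (∀ K : Set (ℝ × Euc m), K ⊆ (Ioi (0:ℝ)) ×ˢ univ → IsCompact K → τ K < ⊤) ∧
    (∀ᵐ x ∂τ, ‖h x‖ = 1) ∧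
    ∀ φ : ℝ × Euc m → ℝ, ContDiff ℝ 1 φ → HasCompactSupport φ →
      tsupport φ ⊆ (Ioi (0:ℝ)) ×ˢ (univ : Set (Euc m)) →
      ∀ y : Euc m,
        (∫ x in (Ioi (0:ℝ)) ×ˢ (univ : Set (Euc m)), f x * fderiv ℝ φ x ((0:ℝ), y))
          = -∫ x, φ x * ⟪h x, y⟫ ∂τ

/-- The barycentre function `b_E(r) = r^{1-n} ∫_{E_r} x̂ dH^{n-1}`. -/
def bary (n : ℕ) (E : Set (Euc n)) (r : ℝ) : Euc n :=
  (r ^ (n - 1))⁻¹ • ∫ x in E ∩ sphere (0 : Euc n) r, hatv x ∂μH[(n : ℝ) - 1]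

/-- The average direction `d_E(r)` of the slice `E_r`. -/
def avgDir (n : ℕ) (α : ℝ → ℝ) (E : Set (Euc n)) (r : ℝ) : Euc n :=
  (omegaBall (n - 1) * Real.sin (α r) ^ (n - 1) * r ^ (n - 1))⁻¹ •
    ∫ x in E ∩ sphere (0 : Euc n) r, hatv x ∂μH[(n : ℝ) - 1]

end

/-- Little-o characterisation of density zero, abstract version. -/
lemma tendsto_div_zero_iff {f g : ℝ → ℝ≥0∞} (c : ℝ) (hc : 0 < c) (d : ℕ)
    (hg : ∀ ρ > 0, g ρ = ENNReal.ofReal (c * ρ ^ d)) :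
    Tendsto (fun ρ => f ρ / g ρ) (𝓝[>] (0:ℝ)) (𝓝 0) ↔
      ∀ ε > (0:ℝ), ∀ᶠ ρ in 𝓝[>] (0:ℝ), f ρ ≤ ENNReal.ofReal (ε * ρ ^ d) := by
  rw [ENNReal.tendsto_nhds_zero]
  constructor
  · intro h ε hε
    filter_upwards [h (ENNReal.ofReal (ε / c)) (by simp; positivity), self_mem_nhdsWithin]
      with ρ h1 h2
    have h2' : (0:ℝ) < ρ := h2
    have hp : 0 < c * ρ ^ d := by positivity
    rw [hg ρ h2, ENNReal.div_le_iff (by simpa using hp) (by simp),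
      ← ENNReal.ofReal_mul (by positivity)] at h1
    refine h1.trans (le_of_eq ?_)
    congr 1
    field_simp
  · intro h e he
    rcases eq_or_ne e ⊤ with rfl | hne
    · simp
    have her : 0 < e.toReal := ENNReal.toReal_pos he.ne' hne
    filter_upwards [h (e.toReal * c) (by positivity), self_mem_nhdsWithin] with ρ h1 h2
    have h2' : (0:ℝ) < ρ := h2
    have hp : 0 < c * ρ ^ d := by positivity
    rw [hg ρ h2, ENNReal.div_le_iff (by simpa using hp) (by simp)]
    refine h1.trans (le_of_eq ?_)
    rw [mul_assoc, ENNReal.ofReal_mul her.le, ENNReal.ofReal_toReal hne]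

lemma rdensity0_iff (S : Set ℝ) (x : ℝ) :
    RDensity0 S x ↔ ∀ ε > (0:ℝ), ∀ᶠ ρ in 𝓝[>] (0:ℝ),
      volume.real (S ∩ ball x ρ) ≤ ε * ρ := by
  unfold RDensity0
  rw [tendsto_div_zero_iff 2 (by norm_num) 1 (fun ρ _ => by rw [Real.volume_ball, pow_one])]
  refine forall₂_congr fun ε hε => ?_
  constructor <;> intro h <;> filter_upwards [h, self_mem_nhdsWithin] with ρ h1 h2
  · have h2' : (0:ℝ) < ρ := h2
    have := ENNReal.toReal_mono (by simp) h1
    rwa [ENNReal.toReal_ofReal (by positivity), pow_one] at this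
  · rw [pow_one]
    rw [← ENNReal.ofReal_toReal (a := volume (S ∩ ball x ρ))
      ((measure_mono inter_subset_right).trans_lt measure_ball_lt_top).ne]
    exact ENNReal.ofReal_le_ofReal h1

lemma vol_ball {n : ℕ} (hn : 2 ≤ n) (x : Euc n) {ρ : ℝ} (hρ : 0 ≤ ρ) :
    volume.real (ball x ρ) = volume.real (ball (0 : Euc n) 1) * ρ ^ n := by
  have : Nontrivial (Euc n) := by
    have : Nonempty (Fin n) := ⟨⟨0, lt_of_lt_of_le two_pos hn⟩⟩
    infer_instance
  rw [measureReal_def, Measure.addHaar_ball _ _ hρ, ENNReal.toReal_mul,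
    ENNReal.toReal_ofReal (by positivity), measureReal_def, mul_comm]
  simp

lemma vol_unit_pos (n : ℕ) : 0 < volume.real (ball (0 : Euc n) 1) :=
  ENNReal.toReal_pos (measure_ball_pos _ _ one_pos).ne' measure_ball_lt_top.ne

lemma density0_iff {n : ℕ} (hn : 2 ≤ n) (E : Set (Euc n)) (x : Euc n) :
    DensityAt E x 0 ↔ ∀ ε > (0:ℝ), ∀ᶠ ρ in 𝓝[>] (0:ℝ),
      volume.real (E ∩ ball x ρ) ≤ ε * ρ ^ n := by
  unfold DensityAt
  rw [tendsto_div_zero_iff (volume.real (ball (0 : Euc n) 1)) (vol_unit_pos n) n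
    (fun ρ hρ => by
      rw [← vol_ball hn x (le_of_lt hρ), measureReal_def,
        ENNReal.ofReal_toReal measure_ball_lt_top.ne])]
  refine forall₂_congr fun ε hε => ?_
  constructor <;> intro h <;> filter_upwards [h, self_mem_nhdsWithin] with ρ h1 h2
  · have h2' : (0:ℝ) < ρ := h2
    have := ENNReal.toReal_mono (by simp) h1
    rwa [ENNReal.toReal_ofReal (by positivity)] at this
  · rw [← ENNReal.ofReal_toReal (a := volume (E ∩ ball x ρ))
      ((measure_mono inter_subset_right).trans_lt measure_ball_lt_top).ne]
    exact ENNReal.ofReal_le_ofReal h1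

lemma DensityAt.mono {n : ℕ} {E G : Set (Euc n)} {x : Euc n} (h : DensityAt G x 0)
    (hEG : E ⊆ G) : DensityAt E x 0 := by
  refine tendsto_of_tendsto_of_tendsto_of_le_of_le tendsto_const_nhds h (fun _ => zero_le) ?_
  intro ρ
  dsimp only
  gcongr

lemma RDensity0.mono {E G : Set ℝ} {x : ℝ} (h : RDensity0 G x)
    (hEG : E ⊆ G) : RDensity0 E x := by
  refine tendsto_of_tendsto_of_tendsto_of_le_of_le tendsto_const_nhds h (fun _ => zero_le) ?_
  intro ρ
  dsimp only
  gcongr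

lemma RDensity0.union {E G : Set ℝ} {x : ℝ} (h : RDensity0 G x) (h' : RDensity0 E x) :
    RDensity0 (E ∪ G) x := by
  have := h'.add h
  rw [add_zero] at this
  refine tendsto_of_tendsto_of_tendsto_of_le_of_le tendsto_const_nhds this (fun _ => zero_le) ?_
  intro ρ
  dsimp only
  rw [← ENNReal.add_div, union_inter_distrib_right]
  gcongr
  exact measure_union_le _ _

/-- If the set is null near the point then density zero. -/
lemma rdensity0_of_null_near {S : Set ℝ} {x : ℝ} {ε : ℝ} (hε : 0 < ε)
    (h : volume (S ∩ ball x ε) = 0) : RDensity0 S x := by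
  unfold RDensity0
  refine tendsto_const_nhds.congr' ?_
  filter_upwards [Ioo_mem_nhdsGT hε] with ρ hρ
  have : volume (S ∩ ball x ρ) = 0 :=
    measure_mono_null (inter_subset_inter_right _ (ball_subset_ball hρ.2.le)) h
  rw [this, ENNReal.zero_div]

lemma density_congr {n : ℕ} {X Y : Set (Euc n)} {x : Euc n} {t : ℝ≥0∞} (ht : t ≠ ⊤)
    (h : DensityAt (symmDiff X Y) x 0) (hX : DensityAt X x t) : DensityAt Y x t := by
  have key : ∀ A B : Set (Euc n), ∀ ρ : ℝ, volume (A ∩ ball x ρ) / volume (ball x ρ) ≤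
      volume (B ∩ ball x ρ) / volume (ball x ρ) +
      volume (symmDiff A B ∩ ball x ρ) / volume (ball x ρ) := by
    intro A B ρ
    rw [← ENNReal.add_div]
    gcongr
    refine (measure_mono ?_).trans (measure_union_le _ _)
    intro y hy
    by_cases hB : y ∈ B
    · exact Or.inl ⟨hB, hy.2⟩
    · exact Or.inr ⟨Or.inl ⟨hy.1, hB⟩, hy.2⟩
  have h1 := ENNReal.Tendsto.sub hX h (Or.inl ht)
  have h2 := hX.add h
  rw [tsub_zero] at h1
  rw [add_zero] at h2
  refine tendsto_of_tendsto_of_tendsto_of_le_of_le h1 h2 ?_ ?_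
  · intro ρ
    exact tsub_le_iff_right.2 (key X Y ρ)
  · intro ρ
    have := key Y X ρ
    rwa [symmDiff_comm] at this

lemma mem_essBoundary_congr {n : ℕ} {X Y : Set (Euc n)} {x : Euc n}
    (h : DensityAt (symmDiff X Y) x 0) : x ∈ essBoundary X ↔ x ∈ essBoundary Y := by
  have h' : DensityAt (symmDiff Y X) x 0 := by rwa [symmDiff_comm]
  have a0 : DensityAt X x 0 ↔ DensityAt Y x 0 :=
    ⟨density_congr (by simp) h, density_congr (by simp) h'⟩
  have a1 : DensityAt X x 1 ↔ DensityAt Y x 1 :=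
    ⟨density_congr (by simp) h, density_congr (by simp) h'⟩
  simp only [essBoundary, mem_ofPred_eq, a0, a1]

lemma density0_of_disjoint_near {n : ℕ} {E U : Set (Euc n)} {x : Euc n}
    (hU : U ∈ 𝓝 x) (h : E ∩ U = ∅) : DensityAt E x 0 := by
  obtain ⟨ε, hε, hb⟩ := Metric.mem_nhds_iff.1 hU
  unfold DensityAt
  refine tendsto_const_nhds.congr' ?_
  filter_upwards [Ioo_mem_nhdsGT hε] with ρ hρ
  have : E ∩ ball x ρ = ∅ := by
    rw [← subset_empty_iff, ← h]
    exact inter_subset_inter_right _ ((ball_subset_ball hρ.2.le).trans hb)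
  rw [this, measure_empty, ENNReal.zero_div]

lemma mem_essBoundary_congr_local {n : ℕ} {X Y U : Set (Euc n)} {x : Euc n}
    (hU : U ∈ 𝓝 x) (h : X ∩ U = Y ∩ U) : x ∈ essBoundary X ↔ x ∈ essBoundary Y := by
  apply mem_essBoundary_congr
  apply density0_of_disjoint_near hU
  ext y
  have := Set.ext_iff.1 h y
  simp only [mem_inter_iff, Set.mem_symmDiff, mem_empty_iff_false, iff_false] at this ⊢
  tauto

lemma density_one_iff {n : ℕ} {E : Set (Euc n)} (hE : MeasurableSet E) (x : Euc n) :
    DensityAt E x 1 ↔ DensityAt Eᶜ x 0 := by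
  have key : ∀ G : Set (Euc n), MeasurableSet G → ∀ ρ > (0:ℝ),
      volume (Gᶜ ∩ ball x ρ) / volume (ball x ρ) =
        1 - volume (G ∩ ball x ρ) / volume (ball x ρ) := by
    intro G hG ρ hρ
    have h0 : volume (ball x ρ) ≠ 0 := (measure_ball_pos _ _ hρ).ne'
    have ht : volume (ball x ρ) ≠ ⊤ := measure_ball_lt_top.ne
    have hs : volume (G ∩ ball x ρ) / volume (ball x ρ) +
        volume (Gᶜ ∩ ball x ρ) / volume (ball x ρ) = 1 := by
      rw [← ENNReal.add_div, inter_comm, inter_comm Gᶜ, ← sdiff_eq,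
        measure_inter_add_sdiff _ hG, ENNReal.div_self h0 ht]
    rw [← hs]
    refine (ENNReal.add_sub_cancel_left ?_).symm
    intro hh
    rw [hh] at hs
    simp at hs
  unfold DensityAt
  constructor
  · intro h
    have := ENNReal.Tendsto.sub (tendsto_const_nhds (x := (1:ℝ≥0∞)) (f := 𝓝[>] (0:ℝ))) h
      (Or.inl (by simp))
    rw [tsub_self] at this
    refine this.congr' ?_
    filter_upwards [self_mem_nhdsWithin] with ρ hρ
    rw [key E hE ρ hρ]
  · intro h
    have := ENNReal.Tendsto.sub (tendsto_const_nhds (x := (1:ℝ≥0∞)) (f := 𝓝[>] (0:ℝ))) h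
      (Or.inl (by simp))
    rw [tsub_zero] at this
    refine this.congr' ?_
    filter_upwards [self_mem_nhdsWithin] with ρ hρ
    have := key Eᶜ hE.compl ρ hρ
    rw [compl_compl] at this
    rw [this]

lemma density_image {n : ℕ} (R : Euc n ≃ₗᵢ[ℝ] Euc n) (E : Set (Euc n)) (x : Euc n) (t : ℝ≥0∞) :
    DensityAt (R '' E) (R x) t ↔ DensityAt E x t := by
  unfold DensityAt
  have h1 : ∀ S : Set (Euc n), volume (R '' S) = volume S := by
    intro S
    have := R.symm.measurePreserving.measure_preimage_emb
      R.symm.toHomeomorph.measurableEmbedding S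
    rw [← this]
    congr 1
    ext y
    constructor
    · rintro ⟨z, hz, rfl⟩
      simpa using hz
    · intro hy
      exact ⟨R.symm y, hy, by simp⟩
  have h2 : ∀ ρ, ball (R x) ρ = R '' (ball x ρ) := fun ρ => by simp
  simp only [h2, ← image_inter R.injective, h1]

lemma essBoundary_image {n : ℕ} (R : Euc n ≃ₗᵢ[ℝ] Euc n) (E : Set (Euc n)) :
    essBoundary (R '' E) = R '' essBoundary E := by
  ext y
  obtain ⟨x, rfl⟩ := R.surjective y
  rw [R.injective.mem_set_image]
  simp only [essBoundary, mem_ofPred_eq, density_image]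

lemma hasDerivAt_of_rdensity0 {S : Set ℝ} {c x : ℝ} (hcx : c < x) (h : RDensity0 S x) :
    HasDerivAt (fun y => volume.real (S ∩ Ioc c y)) 0 x := by
  rw [hasDerivAt_iff_isLittleO, Asymptotics.isLittleO_iff]
  intro ε hε
  obtain ⟨δ, hδ, hδ'⟩ := mem_nhdsGT_iff_exists_Ioo_subset.1 ((rdensity0_iff S x).1 h (ε/2) (by positivity))
  have hδ0 : (0:ℝ) < δ := hδ
  have hfin : ∀ u v : ℝ, volume (S ∩ Ioc u v) ≠ ⊤ := fun u v =>
    ((measure_mono inter_subset_right).trans_lt measure_Ioc_lt_top).ne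
  have hfinb : ∀ u v : ℝ, volume (S ∩ ball u v) ≠ ⊤ := fun u v =>
    ((measure_mono inter_subset_right).trans_lt measure_ball_lt_top).ne
  have key : ∀ u v : ℝ, c ≤ u → u ≤ v → |volume.real (S ∩ Ioc c v) - volume.real (S ∩ Ioc c u)| ≤
      volume.real (S ∩ Ioc u v) := by
    intro u v hu huv
    have h1 : volume.real (S ∩ Ioc c u) ≤ volume.real (S ∩ Ioc c v) :=
      measureReal_mono (inter_subset_inter_right _ (Ioc_subset_Ioc_right huv)) (hfin _ _)
    have h2 : volume.real (S ∩ Ioc c v) ≤ volume.real (S ∩ Ioc c u) + volume.real (S ∩ Ioc u v) := by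
      rw [← Ioc_union_Ioc_eq_Ioc hu huv, inter_union_distrib_left]
      exact measureReal_union_le _ _
    rw [abs_of_nonneg (by linarith)]
    linarith
  filter_upwards [Ioi_mem_nhds hcx, Metric.ball_mem_nhds x (half_pos hδ0)] with y hy1 hy2
  have hy1' : c < y := hy1
  rw [mem_ball, Real.dist_eq] at hy2
  rcases eq_or_ne y x with rfl | hne
  · simp
  have hpos : 0 < |y - x| := abs_pos.2 (sub_ne_zero.2 hne)
  have hb : volume.real (S ∩ ball x (2 * |y - x|)) ≤ ε/2 * (2 * |y - x|) :=
    hδ' ⟨by positivity, by linarith⟩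
  simp only [smul_zero, sub_zero, Real.norm_eq_abs]
  refine le_trans ?_ (hb.trans (le_of_eq (by ring)))
  rcases le_total x y with hxy | hxy
  · refine (key x y hcx.le hxy).trans (measureReal_mono (inter_subset_inter_right _ ?_) (hfinb _ _))
    intro z hz
    rw [mem_ball, Real.dist_eq, abs_of_nonneg (by linarith [hz.1] : 0 ≤ z - x),
      abs_of_nonneg (by linarith : 0 ≤ y - x)]
    rw [abs_of_nonneg (by linarith : 0 ≤ y - x)] at hpos
    linarith [hz.2]
  · rw [abs_sub_comm]
    refine (key y x hy1'.le hxy).trans (measureReal_mono (inter_subset_inter_right _ ?_) (hfinb _ _))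
    intro z hz
    rw [mem_ball, Real.dist_eq, abs_of_nonpos (by linarith [hz.2] : z - x ≤ 0),
      abs_of_nonpos (by linarith : y - x ≤ 0)]
    rw [abs_of_nonpos (by linarith : y - x ≤ 0)] at hpos
    linarith [hz.1]

/-- In dimension one, a measurable set with empty essential boundary in an interval is trivial. -/
lemma trivial_of_density {A : Set ℝ} (hA : MeasurableSet A) {c d : ℝ}
    (h : ∀ x ∈ Ioo c d, RDensity0 A x ∨ RDensity0 Aᶜ x) :
    volume (A ∩ Ioo c d) = 0 ∨ volume (Aᶜ ∩ Ioo c d) = 0 := by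
  classical
  have hfin : ∀ S : Set ℝ, ∀ u v : ℝ, volume (S ∩ Ioc u v) ≠ ⊤ := fun S u v =>
    ((measure_mono inter_subset_right).trans_lt measure_Ioc_lt_top).ne
  set f : ℝ → ℝ := fun y => volume.real (A ∩ Ioc c y) with hf
  set g : ℝ → ℝ := fun y => volume.real (Aᶜ ∩ Ioc c y) with hg
  have hsum : ∀ y, c ≤ y → f y + g y = y - c := by
    intro y hy
    have := measureReal_inter_add_sdiff (μ := volume) (s := Ioc c y) hA measure_Ioc_lt_top.ne
    rw [Real.volume_real_Ioc_of_le hy] at this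
    rw [← this]
    simp only [hf, hg, sdiff_eq, inter_comm]
  have hd1 : ∀ x ∈ Ioo c d, RDensity0 Aᶜ x → HasDerivAt f 1 x := by
    intro x hx hx'
    have h1 := (hasDerivAt_id x).sub_const c |>.sub (hasDerivAt_of_rdensity0 hx.1 hx')
    rw [sub_zero] at h1
    refine h1.congr_of_eventuallyEq ?_
    filter_upwards [Ioi_mem_nhds hx.1] with y hy
    have := hsum y (le_of_lt hy)
    simp only [hf, hg, Pi.sub_apply, id] at this ⊢
    linarith
  have hnull : ∀ S : Set ℝ, (∀ x ∈ Ioo c d, RDensity0 S x) → volume (S ∩ Ioo c d) = 0 := by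
    intro S hS
    have hz : ∀ u v, c < u → u ≤ v → v < d → volume (S ∩ Ioc u v) = 0 := by
      intro u v hu huv hv
      have hder : ∀ x ∈ Icc u v, HasDerivAt (fun y => volume.real (S ∩ Ioc u y)) 0 x ∨ x = u := by
        intro x hx
        rcases eq_or_lt_of_le hx.1 with h | h
        · exact Or.inr h.symm
        · exact Or.inl (hasDerivAt_of_rdensity0 h (hS x ⟨by linarith, by linarith [hx.2]⟩))
      have hd2 : ∀ x ∈ Ioo c d, HasDerivAt (fun y => volume.real (S ∩ Ioc c y)) 0 x := fun x hx =>
        hasDerivAt_of_rdensity0 hx.1 (hS x hx)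
      have hconst : volume.real (S ∩ Ioc c v) = volume.real (S ∩ Ioc c u) := by
        refine constant_of_has_deriv_right_zero (f := fun y => volume.real (S ∩ Ioc c y))
          (a := u) (b := v) ?_ ?_ v ⟨huv, le_rfl⟩
        · intro x hx
          exact (hd2 x ⟨by linarith [hx.1], by linarith [hx.2]⟩).continuousAt.continuousWithinAt
        · intro x hx
          exact (hd2 x ⟨by linarith [hx.1], by linarith [hx.2]⟩).hasDerivWithinAt
      have hadd : volume.real (S ∩ Ioc c v) = volume.real (S ∩ Ioc c u) + volume.real (S ∩ Ioc u v) := by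
        have := measureReal_inter_add_sdiff (μ := volume) (s := S ∩ Ioc c v) (t := Iic u)
          measurableSet_Iic (hfin _ _ _)
        rw [← this]
        congr 2
        · ext z; simp only [mem_inter_iff, mem_Ioc, mem_Iic]
          constructor
          · rintro ⟨⟨a, b, e⟩, f⟩; exact ⟨a, b, f⟩
          · rintro ⟨a, b, e⟩; exact ⟨⟨a, b, e.trans huv⟩, e⟩
        · ext z; simp only [mem_inter_iff, mem_Ioc, mem_Iic, Set.mem_sdiff, not_le]
          constructor
          · rintro ⟨⟨a, b, e⟩, f⟩; exact ⟨a, f, e⟩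
          · rintro ⟨a, b, e⟩; exact ⟨⟨a, hu.trans b, e⟩, b⟩
      have : volume.real (S ∩ Ioc u v) = 0 := by linarith
      exact (measureReal_eq_zero_iff (hfin _ _ _)).1 this
    rcases le_or_gt d c with hdc | hcd
    · simp [Ioo_eq_empty_of_le hdc]
    refine measure_mono_null (t := ⋃ k : ℕ, S ∩ Ioc (c + (d-c)/(k+3)) (d - (d-c)/(k+3))) ?_ ?_
    · intro z hz
      obtain ⟨k, hk⟩ := exists_nat_gt ((d-c) / min (z-c) (d-z))
      have hm : 0 < min (z-c) (d-z) := lt_min (by linarith [hz.2.1]) (by linarith [hz.2.2])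
      have hlt : (d-c)/(k+3) < min (z-c) (d-z) := by
        rw [div_lt_iff₀ (by positivity)]
        rw [div_lt_iff₀ hm] at hk
        nlinarith
      refine mem_iUnion.2 ⟨k, hz.1, ?_, ?_⟩
      · linarith [min_le_left (z-c) (d-z)]
      · linarith [min_le_right (z-c) (d-z)]
    · refine measure_iUnion_null fun k => hz _ _ ?_ ?_ ?_
      · have : 0 < (d-c)/((k:ℝ)+3) := div_pos (by linarith) (by positivity)
        linarith
      · have : (d-c)/((k:ℝ)+3) ≤ (d-c)/2 :=
          div_le_div_of_nonneg_left (by linarith) (by norm_num) (by linarith [k.cast_nonneg (α := ℝ)])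
        linarith
      · have : 0 < (d-c)/((k:ℝ)+3) := div_pos (by linarith) (by positivity)
        linarith
  set f' : ℝ → ℝ := fun x => if RDensity0 A x then 0 else 1 with hf'
  have hder : ∀ x ∈ Ioo c d, HasDerivWithinAt f (f' x) (Ioo c d) x := by
    intro x hx
    by_cases hx' : RDensity0 A x
    · have : f' x = 0 := by simp [hf', hx']
      rw [this]
      exact (hasDerivAt_of_rdensity0 hx.1 hx').hasDerivWithinAt
    · have : f' x = 1 := by simp [hf', hx']
      rw [this]
      exact (hd1 x hx ((h x hx).resolve_left hx')).hasDerivWithinAt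
  rcases hasDerivWithinAt_forall_lt_or_forall_gt_of_forall_ne (convex_Ioo c d) hder (m := 1/2)
    (by intro x _; simp only [hf']; split_ifs <;> norm_num) with hh | hh
  · left
    apply hnull
    intro x hx
    by_contra hx'
    have := hh x hx
    simp only [hf', hx', if_false] at this
    norm_num at this
  · right
    apply hnull
    intro x hx
    refine (h x hx).resolve_left fun hx' => ?_
    have := hh x hx
    simp only [hf', hx', if_true] at this
    norm_num at this

lemma norm_hatv {n : ℕ} {x : Euc n} (hx : x ≠ 0) : ‖hatv x‖ = 1 := by
  simp [hatv, norm_smul, hx]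

lemma smul_hatv {n : ℕ} (x : Euc n) : ‖x‖ • hatv x = x := by
  rcases eq_or_ne x 0 with rfl | h
  · simp
  · simp [hatv, h]

lemma hatv_sub_le {n : ℕ} {x y : Euc n} (hx : x ≠ 0) : ‖hatv y - hatv x‖ ≤ 2 / ‖x‖ * ‖y - x‖ := by
  have hx' : 0 < ‖x‖ := norm_pos_iff.2 hx
  rcases eq_or_ne y 0 with rfl | hy
  · have : hatv (0 : Euc n) = 0 := by simp [hatv]
    rw [this, zero_sub, norm_neg, norm_hatv hx, zero_sub, norm_neg]
    field_simp
    norm_num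
  have h1 : ‖x‖ • (hatv y - hatv x) = (‖x‖ - ‖y‖) • hatv y + (y - x) := by
    rw [smul_sub, smul_hatv, sub_smul, smul_hatv]; abel
  have h2 : ‖x‖ * ‖hatv y - hatv x‖ ≤ 2 * ‖y - x‖ := by
    calc ‖x‖ * ‖hatv y - hatv x‖ = ‖‖x‖ • (hatv y - hatv x)‖ := by rw [norm_smul, norm_norm]
      _ = ‖(‖x‖ - ‖y‖) • hatv y + (y - x)‖ := by rw [h1]
      _ ≤ ‖(‖x‖ - ‖y‖) • hatv y‖ + ‖y - x‖ := norm_add_le _ _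
      _ = |‖x‖ - ‖y‖| + ‖y - x‖ := by rw [norm_smul, norm_hatv hy, mul_one, Real.norm_eq_abs]
      _ ≤ ‖y - x‖ + ‖y - x‖ := by
        gcongr
        rw [norm_sub_rev]
        exact abs_norm_sub_norm_le _ _
      _ = _ := by ring
  rw [div_mul_eq_mul_div, le_div_iff₀ hx']
  linarith

lemma measurable_hatv {n : ℕ} : Measurable (hatv : Euc n → Euc n) := by
  unfold hatv; fun_prop

/-- Spherical measure of the set of unit directions in `S`. -/
noncomputable def sphM {n : ℕ} (S : Set (Euc n)) : ℝ :=
  (volume : Measure (Euc n)).toSphere.real ((↑) ⁻¹' S : Set (sphere (0 : Euc n) 1))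

/-- The cone-shell over radii `A` and directions `S`. -/
def coneShell {n : ℕ} (A : Set ℝ) (S : Set (Euc n)) : Set (Euc n) :=
  {y | y ≠ 0 ∧ ‖y‖ ∈ A ∧ hatv y ∈ S}

lemma polar {n : ℕ} (A : Set ℝ) (hA : MeasurableSet A) (hA0 : A ⊆ Ioi 0)
    (S : Set (Euc n)) (hS : MeasurableSet S) :
    volume (coneShell A S) =
      (volume : Measure (Euc n)).toSphere ((↑) ⁻¹' S : Set (sphere (0 : Euc n) 1)) *
        ∫⁻ r in A, ENNReal.ofReal (r ^ (n - 1)) := by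
  have hmp := (volume : Measure (Euc n)).measurePreserving_homeomorphUnitSphereProd
  have h1 := hmp.measure_preimage_emb (Homeomorph.measurableEmbedding _)
    (((↑) ⁻¹' S : Set (sphere (0 : Euc n) 1)) ×ˢ ((↑) ⁻¹' A : Set (Ioi (0:ℝ))))
  rw [Measure.prod_prod, Measure.volumeIoiPow, withDensity_apply _ (measurable_subtype_coe hA),
    setLIntegral_subtype measurableSet_Ioi _ fun a : ℝ ↦ ENNReal.ofReal (a ^ _),
    comap_subtype_coe_apply (measurableSet_singleton _).compl] at h1
  rw [Subtype.image_preimage_coe, inter_eq_right.2 hA0] at h1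
  simp only [finrank_euclideanSpace, Fintype.card_fin] at h1
  rw [← h1]
  congr 1
  ext y
  simp only [coneShell, mem_ofPred_eq, mem_image, mem_preimage, mem_prod, Subtype.exists,
    homeomorphUnitSphereProd_apply_fst_coe, homeomorphUnitSphereProd_apply_snd_coe, mem_compl_iff,
    mem_singleton_iff]
  constructor
  · rintro ⟨h0, ha, hs⟩
    exact ⟨y, h0, ⟨hs, ha⟩, rfl⟩
  · rintro ⟨z, h0, ⟨hs, ha⟩, rfl⟩
    exact ⟨h0, ha, hs⟩

lemma coneShell_real {n : ℕ} {A : Set ℝ} (hA : MeasurableSet A) {a b : ℝ} (ha : 0 < a)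
    (hA0 : A ⊆ Icc a b) {S : Set (Euc n)} (hS : MeasurableSet S) :
    sphM S * (a ^ (n - 1) * volume.real A) ≤ volume.real (coneShell A S) ∧
    volume.real (coneShell A S) ≤ sphM S * (b ^ (n - 1) * volume.real A) := by
  have hAfin : volume A ≠ ⊤ := ((measure_mono hA0).trans_lt measure_Icc_lt_top).ne
  have hp := polar A hA (fun x hx => ha.trans_le (hA0 hx).1) S hS
  have hl : ENNReal.ofReal (a ^ (n-1)) * volume A ≤ ∫⁻ r in A, ENNReal.ofReal (r ^ (n - 1)) := by
    rw [← setLIntegral_const]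
    refine setLIntegral_mono' hA fun r hr => ENNReal.ofReal_le_ofReal ?_
    exact pow_le_pow_left₀ ha.le (hA0 hr).1 _
  have hu : ∫⁻ r in A, ENNReal.ofReal (r ^ (n - 1)) ≤ ENNReal.ofReal (b ^ (n-1)) * volume A := by
    rw [← setLIntegral_const]
    refine setLIntegral_mono' hA fun r hr => ENNReal.ofReal_le_ofReal ?_
    exact pow_le_pow_left₀ (ha.le.trans (hA0 hr).1) (hA0 hr).2 _
  have hufin : ENNReal.ofReal (b ^ (n-1)) * volume A ≠ ⊤ := ENNReal.mul_ne_top (by simp) hAfin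
  have hfin := (hu.trans_lt hufin.lt_top).ne
  have hreal : volume.real (coneShell A S) =
      sphM S * (∫⁻ r in A, ENNReal.ofReal (r ^ (n - 1))).toReal := by
    rw [measureReal_def, hp, ENNReal.toReal_mul]; rfl
  have hnn : 0 ≤ sphM S := measureReal_nonneg
  rw [hreal]
  constructor
  · apply mul_le_mul_of_nonneg_left _ hnn
    have := ENNReal.toReal_mono hfin hl
    rwa [ENNReal.toReal_mul, ENNReal.toReal_ofReal (by positivity)] at this
  · rcases A.eq_empty_or_nonempty with rfl | ⟨z, hz⟩
    · simp
    have hb : 0 ≤ b := ha.le.trans ((hA0 hz).1.trans (hA0 hz).2)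
    apply mul_le_mul_of_nonneg_left _ hnn
    have := ENNReal.toReal_mono hufin hu
    rwa [ENNReal.toReal_mul, ENNReal.toReal_ofReal (by positivity)] at this

lemma hatv_smul_unit {n : ℕ} {ω : Euc n} (hω : ‖ω‖ = 1) {r : ℝ} (hr : 0 < r) :
    hatv (r • ω) = ω := by
  rw [hatv, norm_smul, hω, mul_one, Real.norm_eq_abs, abs_of_pos hr, smul_smul,
    inv_mul_cancel₀ hr.ne', one_smul]

lemma sphM_bounds {n : ℕ} (hn : 2 ≤ n) : ∃ c1 > (0:ℝ), ∃ c2 > (0:ℝ), ∀ ω : Euc n, ‖ω‖ = 1 →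
    ∀ δ : ℝ, 0 < δ → δ ≤ 1/2 →
      c1 * δ ^ (n-1) ≤ sphM (ball ω δ) ∧ sphM (ball ω δ) ≤ c2 * δ ^ (n-1) := by
  have hV := vol_unit_pos n
  set V := volume.real (ball (0 : Euc n) 1) with hVdef
  refine ⟨V / (2^n * 2^n), by positivity, V * 2^n * 2^n, by positivity, ?_⟩
  intro ω hω δ hδ hδ2
  have hsub : Icc (1-δ) (1+δ) ⊆ Icc (1-δ) (1+δ) := le_rfl
  have hcs := coneShell_real (n := n) (measurableSet_Icc (a := 1-δ) (b := 1+δ)) (by linarith) hsub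
    (measurableSet_ball (x := ω) (ε := δ))
  have hvol : volume.real (Icc (1-δ) (1+δ)) = 2 * δ := by
    rw [Real.volume_real_Icc_of_le (by linarith)]; ring
  rw [hvol] at hcs
  have hin : coneShell (Icc (1-δ) (1+δ)) (ball ω δ) ⊆ ball ω (2*δ) := by
    rintro y ⟨hy0, hy1, hy2⟩
    rw [mem_ball, dist_eq_norm] at hy2 ⊢
    have h1 : y - ω = (‖y‖ - 1) • hatv y + (hatv y - ω) := by
      rw [sub_smul, smul_hatv, one_smul]; abel
    rw [h1]
    refine (norm_add_le _ _).trans_lt ?_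
    rw [norm_smul, norm_hatv hy0, mul_one, Real.norm_eq_abs]
    have : |‖y‖ - 1| ≤ δ := abs_le.2 ⟨by linarith [hy1.1], by linarith [hy1.2]⟩
    linarith
  have hout : ball ω (δ/2) ⊆ coneShell (Icc (1-δ) (1+δ)) (ball ω δ) := by
    intro y hy
    rw [mem_ball, dist_eq_norm] at hy
    have h1 : |‖y‖ - 1| < δ/2 := by
      rw [← hω]; exact (abs_norm_sub_norm_le y ω).trans_lt hy
    rw [abs_lt] at h1
    have hy0 : y ≠ 0 := by
      rintro rfl; rw [norm_zero] at h1; linarith [h1.1]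
    refine ⟨hy0, ⟨by linarith [h1.1], by linarith [h1.2]⟩, ?_⟩
    rw [mem_ball, dist_eq_norm]
    have h2 : hatv y - ω = (1 - ‖y‖) • hatv y + (y - ω) := by
      rw [sub_smul, smul_hatv, one_smul]; abel
    rw [h2]
    refine (norm_add_le _ _).trans_lt ?_
    rw [norm_smul, norm_hatv hy0, mul_one, Real.norm_eq_abs]
    have : |1 - ‖y‖| < δ/2 := abs_lt.2 ⟨by linarith, by linarith⟩
    linarith
  have hinm := measureReal_mono (μ := volume) hin measure_ball_lt_top.ne
  have houtm := measureReal_mono (μ := volume) hout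
    ((measure_mono hin).trans_lt measure_ball_lt_top).ne
  rw [vol_ball hn _ (by positivity), ← hVdef] at hinm houtm
  have hs : 0 ≤ sphM (ball ω δ) := measureReal_nonneg
  obtain ⟨m, rfl⟩ : ∃ m, n = m + 1 := ⟨n - 1, by omega⟩
  simp only [Nat.add_sub_cancel] at hcs ⊢
  have hδm : 0 < δ ^ m := by positivity
  constructor
  · have h1 : V * (δ/2)^(m+1) ≤ sphM (ball ω δ) * (2 ^ m * (2*δ)) := by
      refine houtm.trans (hcs.2.trans ?_)
      gcongr
      linarith
    rw [div_mul_eq_mul_div, div_le_iff₀ (by positivity)]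
    have h2 : V * (δ/2)^(m+1) = (V * δ^m) * (δ / 2^(m+1)) := by
      rw [div_pow, pow_succ δ m]; ring
    have h3 : sphM (ball ω δ) * (2 ^ m * (2*δ)) =
        (sphM (ball ω δ) * (2^(m+1) * 2^(m+1))) * (δ / 2^(m+1)) := by
      field_simp
      ring
    rw [h2, h3] at h1
    exact le_of_mul_le_mul_right h1 (by positivity)
  · have h1 : sphM (ball ω δ) * ((1/2)^m * (2*δ)) ≤ V * (2*δ)^(m+1) := by
      refine le_trans ?_ (hcs.1.trans hinm)
      gcongr
      linarith
    have h2 : V * (2*δ)^(m+1) = (V * 2^m * 2^m * δ^m) * ((1/2)^m * (2*δ)) := by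
      rw [pow_succ, mul_pow, one_div, inv_pow]
      field_simp
    rw [h2] at h1
    have h3 := le_of_mul_le_mul_right h1 (by positivity)
    refine h3.trans ?_
    gcongr <;> norm_num

lemma norm_sub_smul_lt {n : ℕ} {ω y : Euc n} {r ρ : ℝ} (hr : 0 < r) (hy0 : y ≠ 0)
    (hy1 : |‖y‖ - r| < ρ) (hy2 : ‖hatv y - ω‖ ≤ ρ) : ‖y - r • ω‖ < (1 + r) * ρ := by
  have h1 : y - r • ω = (‖y‖ - r) • hatv y + r • (hatv y - ω) := by
    rw [sub_smul, smul_hatv, smul_sub]; abel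
  rw [h1]
  refine (norm_add_le _ _).trans_lt ?_
  rw [norm_smul, norm_hatv hy0, mul_one, Real.norm_eq_abs, norm_smul, Real.norm_eq_abs,
    abs_of_pos hr]
  nlinarith

/-- Lower estimate: directional cones inside `G` force one-dimensional density zero. -/
lemma rdensity0_of_density0 {n : ℕ} (hn : 2 ≤ n) {G : Set (Euc n)} {A : Set ℝ}
    (hA : MeasurableSet A) {r : ℝ} (hr : 0 < r) {ω : Euc n} {c : ℝ} (hc : 0 < c)
    (hc1 : c < 1)
    (hcone : ∀ᶠ ρ in 𝓝[>] (0:ℝ), ∃ ω' : Euc n, ‖ω'‖ = 1 ∧ ball ω' (c * ρ) ⊆ ball ω ρ ∧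
      coneShell A (ball ω' (c * ρ)) ⊆ G)
    (hG : DensityAt G (r • ω) 0) : RDensity0 A r := by
  obtain ⟨c1, hc1pos, c2, hc2pos, hb⟩ := sphM_bounds hn
  rw [rdensity0_iff]
  intro ε hε
  set K := c1 * c^(n-1) * (r/2)^(n-1) with hK
  have hKpos : 0 < K := by positivity
  have hd := (density0_iff hn _ _).1 hG (ε * K / (1+r)^n) (by positivity)
  have ht : Tendsto (fun ρ : ℝ => (1+r) * ρ) (𝓝[>] 0) (𝓝[>] 0) := by
    refine tendsto_nhdsWithin_iff.2 ⟨?_, ?_⟩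
    · refine Tendsto.mono_left ?_ nhdsWithin_le_nhds
      have : ContinuousAt (fun ρ : ℝ => (1+r) * ρ) 0 := by fun_prop
      simpa [ContinuousAt] using this
    · filter_upwards [self_mem_nhdsWithin] with ρ hρ
      have : (0:ℝ) < ρ := hρ
      exact mem_Ioi.2 (by positivity)
  filter_upwards [hcone, ht.eventually hd, Ioo_mem_nhdsGT (show (0:ℝ) < 1/2 by norm_num),
    Ioo_mem_nhdsGT (half_pos hr)] with ρ ⟨ω', hω', hsub, hGsub⟩ h2 h3 h4
  have hρ : 0 < ρ := h3.1
  have hin : coneShell (A ∩ ball r ρ) (ball ω' (c*ρ)) ⊆ G ∩ ball (r • ω) ((1+r)*ρ) := by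
    rintro y ⟨hy0, hy1, hy2⟩
    refine ⟨hGsub ⟨hy0, hy1.1, hy2⟩, ?_⟩
    rw [mem_ball, dist_eq_norm]
    refine norm_sub_smul_lt hr hy0 ?_ ?_
    · rw [← Real.dist_eq]; exact hy1.2
    · have := hsub hy2
      rw [mem_ball, dist_eq_norm] at this
      exact this.le
  have hm := measureReal_mono (μ := volume) hin
    ((measure_mono inter_subset_right).trans_lt measure_ball_lt_top).ne
  have hsubI : A ∩ ball r ρ ⊆ Icc (r/2) (2*r) := by
    intro z hz
    have := hz.2
    rw [mem_ball, Real.dist_eq, abs_lt] at this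
    exact ⟨by linarith [h4.2], by linarith [h4.2]⟩
  have hcs := (coneShell_real (n := n) (hA.inter measurableSet_ball) (half_pos hr) hsubI
    (measurableSet_ball (x := ω') (ε := c*ρ))).1
  have hlow := (hb ω' hω' (c*ρ) (by positivity) (by nlinarith [h3.2])).1
  set M := volume.real (A ∩ ball r ρ)
  have hM : 0 ≤ M := measureReal_nonneg
  have h5 : c1 * (c*ρ)^(n-1) * ((r/2)^(n-1) * M) ≤ ε * K / (1+r)^n * ((1+r)*ρ)^n := by
    refine le_trans ?_ (hcs.trans (hm.trans h2))
    gcongr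
  obtain ⟨m, rfl⟩ : ∃ m, n = m + 1 := ⟨n - 1, by omega⟩
  simp only [Nat.add_sub_cancel] at h5 hK
  have h6 : c1 * (c*ρ)^m * ((r/2)^m * M) = M * (K * ρ^m) := by
    rw [hK, mul_pow]; ring
  have h7 : ε * K / (1+r)^(m+1) * ((1+r)*ρ)^(m+1) = (ε * ρ) * (K * ρ^m) := by
    rw [mul_pow, pow_succ ρ m]
    field_simp
  rw [h6, h7] at h5
  exact le_of_mul_le_mul_right h5 (by positivity)

/-- Upper estimate. -/
lemma density0_of_rdensity0 {n : ℕ} (hn : 2 ≤ n) {G U : Set (Euc n)} {A : Set ℝ}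
    (hA : MeasurableSet A) {x : Euc n} (hx : x ≠ 0) (hU : U ∈ 𝓝 x)
    (hGA : ∀ y ∈ G ∩ U, ‖y‖ ∈ A) (hR : RDensity0 A ‖x‖) : DensityAt G x 0 := by
  obtain ⟨c1, hc1pos, c2, hc2pos, hb⟩ := sphM_bounds hn
  have hr : 0 < ‖x‖ := norm_pos_iff.2 hx
  rw [density0_iff hn]
  intro ε hε
  set K := c2 * (2/‖x‖)^(n-1) * (2*‖x‖)^(n-1) with hK
  have hKpos : 0 < K := by positivity
  have hd := (rdensity0_iff _ _).1 hR (ε / K) (by positivity)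
  obtain ⟨δ, hδ, hδU⟩ := Metric.mem_nhds_iff.1 hU
  filter_upwards [hd, Ioo_mem_nhdsGT hδ, Ioo_mem_nhdsGT (half_pos hr),
    Ioo_mem_nhdsGT (show (0:ℝ) < ‖x‖/4 by positivity)] with ρ h1 h2 h3 h4
  have hρ : 0 < ρ := h2.1
  have hin : G ∩ ball x ρ ⊆ coneShell (A ∩ ball ‖x‖ ρ) (ball (hatv x) (2/‖x‖*ρ)) := by
    rintro y ⟨hyG, hyb⟩
    have hyA := hGA y ⟨hyG, hδU (ball_subset_ball h2.2.le hyb)⟩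
    rw [mem_ball, dist_eq_norm] at hyb
    have hn := (abs_norm_sub_norm_le y x).trans_lt hyb
    have hy0 : y ≠ 0 := by
      rintro rfl
      rw [zero_sub, norm_neg] at hyb
      linarith [h3.2]
    refine ⟨hy0, ⟨hyA, ?_⟩, ?_⟩
    · rw [mem_ball, Real.dist_eq]; exact hn
    · rw [mem_ball, dist_eq_norm]
      refine (hatv_sub_le hx).trans_lt ?_
      gcongr
  have hsubI : A ∩ ball ‖x‖ ρ ⊆ Icc (‖x‖/2) (2*‖x‖) := by
    intro z hz
    have := hz.2
    rw [mem_ball, Real.dist_eq, abs_lt] at this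
    exact ⟨by linarith [h3.2], by linarith [h3.2]⟩
  have hcs := (coneShell_real (n := n) (hA.inter measurableSet_ball) (half_pos hr) hsubI
    (measurableSet_ball (x := hatv x) (ε := 2/‖x‖*ρ))).2
  have hfin : volume (coneShell (A ∩ ball ‖x‖ ρ) (ball (hatv x) (2/‖x‖*ρ))) ≠ ⊤ := by
    refine ((measure_mono (t := ball (0 : Euc n) (2*‖x‖ + 1)) ?_).trans_lt measure_ball_lt_top).ne
    rintro y ⟨_, hy, _⟩
    rw [mem_ball, dist_zero_right]
    linarith [(hsubI hy).2]
  have hm := measureReal_mono (μ := volume) hin hfin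
  have hup := (hb (hatv x) (norm_hatv hx) (2/‖x‖*ρ) (by positivity) (by
    rw [div_mul_eq_mul_div, div_le_iff₀ hr]; linarith [h4.2])).2
  set M := volume.real (A ∩ ball ‖x‖ ρ)
  have hM : 0 ≤ M := measureReal_nonneg
  refine hm.trans (hcs.trans ?_)
  calc sphM (ball (hatv x) (2/‖x‖*ρ)) * ((2*‖x‖)^(n-1) * M)
      ≤ (c2 * (2/‖x‖*ρ)^(n-1)) * ((2*‖x‖)^(n-1) * (ε/K*ρ)) := by gcongr
    _ = ε * ρ^n := by
      obtain ⟨m, rfl⟩ : ∃ m, n = m + 1 := ⟨n - 1, by omega⟩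
      simp only [Nat.add_sub_cancel] at hK ⊢
      have : (c2 * (2/‖x‖*ρ)^m) * ((2*‖x‖)^m * (ε/K*ρ)) = K * (ε / K) * (ρ^m*ρ) := by
        rw [hK, mul_pow (2/‖x‖) ρ m]; ring
      rw [this, mul_div_cancel₀ _ hKpos.ne', pow_succ]

set_option maxHeartbeats 1000000 in
/-- Near a unit vector `ω` not parallel to `p`, small balls centred on the sphere and lying
strictly on the side of larger `p`-component. -/
lemma exists_dir {n : ℕ} {ω p : Euc n} (hω : ‖ω‖ = 1) (hp : ‖p‖ = 1)
    (hk : |⟪ω, p⟫| < 1) : ∃ c : ℝ, 0 < c ∧ c < 1 ∧ ∀ᶠ ρ in 𝓝[>] (0:ℝ),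
      ∃ ω' : Euc n, ‖ω'‖ = 1 ∧ ball ω' (c * ρ) ⊆ ball ω ρ ∧
        ∀ y ∈ ball ω' (c * ρ), ⟪ω, p⟫ < ⟪y, p⟫ := by
  set k : ℝ := ⟪ω, p⟫ with hkdef
  have hk2 : 0 < 1 - k^2 := by
    have := (sq_lt_one_iff_abs_lt_one k).2 hk
    linarith
  set s := Real.sqrt (1 - k^2) with hs
  have hs0 : 0 < s := Real.sqrt_pos.2 hk2
  have hssq : s^2 = 1 - k^2 := Real.sq_sqrt hk2.le
  have hs1 : s ≤ 1 := by nlinarith [sq_nonneg k]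
  have hωω : ⟪ω, ω⟫ = (1:ℝ) := by rw [real_inner_self_eq_norm_sq, hω]; norm_num
  have hpp : ⟪p, p⟫ = (1:ℝ) := by rw [real_inner_self_eq_norm_sq, hp]; norm_num
  set u : Euc n := s⁻¹ • (p - k • ω) with hu
  have hωu : ⟪ω, u⟫ = (0:ℝ) := by
    rw [hu, inner_smul_right, inner_sub_right, inner_smul_right, hωω, ← hkdef]; ring
  have hup : ⟪u, p⟫ = s := by
    rw [hu, inner_smul_left, inner_sub_left, inner_smul_left, hpp, ← hkdef]
    simp only [conj_trivial]
    rw [show 1 - k * k = s^2 by rw [hssq]; ring]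
    field_simp
  have huu : ⟪u, u⟫ = (1:ℝ) := by
    have : ⟪u, u⟫ = s⁻¹ * (⟪u, p⟫ - k * ⟪u, ω⟫) := by
      conv_lhs => rw [show (⟪u, u⟫:ℝ) = ⟪u, s⁻¹ • (p - k • ω)⟫ from rfl]
      rw [inner_smul_right, inner_sub_right, inner_smul_right]
    rw [this, hup, real_inner_comm, hωu]
    field_simp
    ring
  have hnu : ‖u‖ = 1 := by
    have := real_inner_self_eq_norm_sq u
    rw [huu] at this
    exact (pow_eq_one_iff_of_nonneg (norm_nonneg u) two_ne_zero).1 this.symm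
  refine ⟨s/16, by positivity, by linarith, ?_⟩
  filter_upwards [Ioo_mem_nhdsGT (show (0:ℝ) < s by exact hs0)] with ρ hρ
  have hρ0 := hρ.1
  have hρs := hρ.2
  set τ := ρ/4 with hτ
  have hτ0 : 0 < τ := by positivity
  have hcos := Real.one_sub_sq_div_two_le_cos (x := τ)
  have hcos1 := Real.cos_le_one τ
  have hsin : τ / 2 ≤ Real.sin τ := by
    have h := Real.mul_le_sin hτ0.le (by have := Real.pi_gt_three; linarith)
    refine le_trans ?_ h
    have : 1/2 ≤ 2/Real.pi := by
      rw [div_le_div_iff₀ (by norm_num) Real.pi_pos]; linarith [Real.pi_le_four]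
    nlinarith
  have hsin1 : Real.sin τ ≤ τ := Real.sin_le hτ0.le
  set ω' : Euc n := Real.cos τ • ω + Real.sin τ • u with hω'
  have hnω' : ‖ω'‖ = 1 := by
    have : ⟪ω', ω'⟫ = (1:ℝ) := by
      rw [hω']
      simp only [inner_add_left, inner_add_right, inner_smul_left, inner_smul_right, conj_trivial,
        hωω, huu, hωu, real_inner_comm ω u]
      nlinarith [Real.sin_sq_add_cos_sq τ]
    have h2 := real_inner_self_eq_norm_sq ω'
    rw [this] at h2
    exact (pow_eq_one_iff_of_nonneg (norm_nonneg ω') two_ne_zero).1 h2.symm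
  have hip : ⟪ω', p⟫ = k * Real.cos τ + s * Real.sin τ := by
    rw [hω', inner_add_left, inner_smul_left, inner_smul_left, hup, ← hkdef]
    simp only [conj_trivial]; ring
  have hgap : k + s/16*ρ ≤ ⟪ω', p⟫ := by
    rw [hip]
    have hk1 : k ≤ 1 := (abs_lt.1 hk).2.le
    have h1 : k * Real.cos τ ≥ k - τ^2/2 := by
      have h9 : (1 - k) * (1 - Real.cos τ) ≥ 0 := mul_nonneg (by linarith) (by linarith)
      linarith
    have h2 : s * Real.sin τ ≥ s * (τ/2) := by gcongr
    have h3 : τ^2/2 ≤ s*τ/4 := by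
      have h8 : τ * τ ≤ (s/4) * τ := mul_le_mul_of_nonneg_right (by linarith) hτ0.le
      rw [pow_two]; nlinarith [mul_pos hs0 hτ0]
    have h4 : s/16*ρ = s*τ/4 := by rw [hτ]; ring
    linarith
  have hdist : ‖ω' - ω‖ ≤ ρ/2 := by
    have : ω' - ω = (Real.cos τ - 1) • ω + Real.sin τ • u := by
      rw [hω', sub_smul, one_smul]; abel
    rw [this]
    refine (norm_add_le _ _).trans ?_
    rw [norm_smul, norm_smul, hω, hnu, mul_one, mul_one, Real.norm_eq_abs, Real.norm_eq_abs,
      abs_of_nonpos (by linarith), abs_of_nonneg (by linarith)]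
    have hτ1 : τ ≤ 1 := by linarith
    have hτ2 : τ^2 ≤ τ := by
      have := mul_le_mul_of_nonneg_left hτ1 hτ0.le
      rw [mul_one] at this
      rw [pow_two]; exact this
    linarith
  refine ⟨ω', hnω', ?_, ?_⟩
  · intro y hy
    rw [mem_ball, dist_eq_norm] at hy ⊢
    have : y - ω = (y - ω') + (ω' - ω) := by abel
    rw [this]
    refine (norm_add_le _ _).trans_lt ?_
    have h7 : s * ρ ≤ 1 * ρ := mul_le_mul_of_nonneg_right hs1 hρ0.le
    linarith
  · intro y hy
    rw [mem_ball, dist_eq_norm] at hy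
    have h1 : ⟪y, p⟫ = ⟪y - ω', p⟫ + ⟪ω', p⟫ := by rw [← inner_add_left]; simp
    have h2 : |⟪y - ω', p⟫| ≤ ‖y - ω'‖ := by
      have := abs_real_inner_le_norm (y - ω') p
      rwa [hp, mul_one] at this
    have h3 := (abs_le.1 h2).1
    linarith

/-- The symmetral written through `γ = cos ∘ α`. -/
def Fset {n : ℕ} (γ : ℝ → ℝ) (p : Euc n) : Set (Euc n) := {y | y ≠ 0 ∧ γ ‖y‖ < ⟪hatv y, p⟫}

lemma measurableSet_Fset {n : ℕ} {γ : ℝ → ℝ} (hγ : Measurable γ) (p : Euc n) :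
    MeasurableSet (Fset γ p) := by
  refine MeasurableSet.inter (measurableSet_singleton _).compl ?_
  exact measurableSet_lt (hγ.comp measurable_norm) (measurable_hatv.inner_const)

lemma core {n : ℕ} (hn : 2 ≤ n) {γ : ℝ → ℝ} (hγ : Measurable γ) {p ω : Euc n} (hp : ‖p‖ = 1)
    (hω : ‖ω‖ = 1) (hk : |⟪ω, p⟫| < 1) {r : ℝ} (hr : 0 < r)
    (h : r • ω ∉ essBoundary (Fset γ p)) :
    RDensity0 {s | γ s < ⟪ω, p⟫} r ∨ RDensity0 {s | γ s < ⟪ω, p⟫}ᶜ r := by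
  have hF := measurableSet_Fset hγ p
  have hA : MeasurableSet {s | γ s < ⟪ω, p⟫} := measurableSet_lt hγ measurable_const
  simp only [essBoundary, mem_ofPred_eq, not_and_or, not_not] at h
  rcases h with h | h
  · left
    obtain ⟨c, hc, hc1, hev⟩ := exists_dir hω hp hk
    refine rdensity0_of_density0 hn hA hr hc hc1 ?_ h
    filter_upwards [hev] with ρ ⟨ω', h1, h2, h3⟩
    refine ⟨ω', h1, h2, ?_⟩
    rintro y ⟨hy0, hy1, hy2⟩
    exact ⟨hy0, lt_trans hy1 (h3 _ hy2)⟩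
  · right
    rw [density_one_iff hF] at h
    obtain ⟨c, hc, hc1, hev⟩ := exists_dir (p := -p) hω (by rw [norm_neg, hp]) (by
      rw [inner_neg_right, abs_neg]; exact hk)
    refine rdensity0_of_density0 hn hA.compl hr hc hc1 ?_ h
    filter_upwards [hev] with ρ ⟨ω', h1, h2, h3⟩
    refine ⟨ω', h1, h2, ?_⟩
    rintro y ⟨hy0, hy1, hy2⟩ ⟨_, hy4⟩
    have := h3 _ hy2
    rw [inner_neg_right, inner_neg_right] at this
    simp only [mem_compl_iff, mem_ofPred_eq, not_lt] at hy1
    linarith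

lemma inner_e1 {n : ℕ} (hn : 0 < n) (x : Euc n) : ⟪x, e1 n hn⟫ = x ⟨0, hn⟩ := by
  simp [e1, EuclideanSpace.inner_single_right]

lemma norm_e1 {n : ℕ} (hn : 0 < n) : ‖e1 n hn‖ = 1 := by
  simp [e1]

lemma zone_pos {n : ℕ} (hn : 2 ≤ n) (hn0 : 0 < n) {k1 k2 : ℝ} (h1 : -1 ≤ k1) (h12 : k1 < k2) (h2 : k2 ≤ 1) :
    0 < μH[(n:ℝ) - 1] {ω : Euc n | ‖ω‖ = 1 ∧ k1 < ⟪ω, e1 n hn0⟫ ∧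
      ⟪ω, e1 n hn0⟫ < k2} := by
  obtain ⟨m, rfl⟩ : ∃ m, n = m + 2 := ⟨n - 2, by omega⟩
  set T := {ω : Euc (m+2) | ‖ω‖ = 1 ∧ k1 < ⟪ω, e1 (m+2) hn0⟫ ∧
      ⟪ω, e1 (m+2) hn0⟫ < k2} with hT
  let f : Euc (m+2) → (Fin (m+1) → ℝ) := fun y i => y (Fin.castSucc i)
  have hf : LipschitzWith 1 f := by
    refine LipschitzWith.of_dist_le_mul fun x y => ?_
    rw [NNReal.coe_one, one_mul]
    refine (dist_pi_le_iff dist_nonneg).2 fun i => ?_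
    rw [dist_eq_norm, dist_eq_norm]
    exact PiLp.norm_apply_le (x - y) (Fin.castSucc i)
  set U : Set (Fin (m+1) → ℝ) := {y | ∑ i, y i ^ 2 < 1 ∧ k1 < y 0 ∧ y 0 < k2} with hU
  have hUo : IsOpen U := by
    have hc0 : Continuous fun y : Fin (m+1) → ℝ => y 0 := continuous_apply 0
    have hc1 : Continuous fun y : Fin (m+1) → ℝ => ∑ i, y i ^ 2 := by fun_prop
    exact IsOpen.inter (isOpen_lt hc1 continuous_const) (IsOpen.inter
      (isOpen_lt continuous_const hc0) (isOpen_lt hc0 continuous_const))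
  have hUne : U.Nonempty := by
    refine ⟨Pi.single 0 ((k1+k2)/2), ?_, ?_, ?_⟩
    · rw [Finset.sum_eq_single 0]
      · simp only [Pi.single_eq_same]
        rw [sq_lt_one_iff_abs_lt_one, abs_lt]
        constructor <;> linarith
      · intro b _ hb
        simp [hb]
      · simp
    · simp only [Pi.single_eq_same]; linarith
    · simp only [Pi.single_eq_same]; linarith
  have hsub : U ⊆ f '' T := by
    rintro y ⟨hy1, hy2, hy3⟩
    refine ⟨WithLp.toLp 2 (Fin.snoc (α := fun _ => ℝ) y (Real.sqrt (1 - ∑ i, y i ^ 2))), ⟨?_, ?_⟩, ?_⟩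
    · rw [EuclideanSpace.norm_eq, Fin.sum_univ_castSucc]
      simp only [Fin.snoc_castSucc, Fin.snoc_last, Real.norm_eq_abs, sq_abs]
      rw [Real.sq_sqrt (by linarith)]
      simp
    · rw [inner_e1]
      have : (⟨0, hn0⟩ : Fin (m+2)) = Fin.castSucc (0 : Fin (m+1)) := rfl
      rw [this]
      simp only [Fin.snoc_castSucc]
      exact ⟨hy2, hy3⟩
    · funext i
      simp [f]
  have hpos : 0 < volume U := hUo.measure_pos volume hUne
  have hd : ((m+2:ℕ):ℝ) - 1 = (Fintype.card (Fin (m+1)) : ℝ) := by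
    simp; ring
  rw [hd]
  have := hf.hausdorffMeasure_image_le (d := (Fintype.card (Fin (m+1)) : ℝ)) (by positivity) T
  rw [hausdorffMeasure_pi_real] at this
  simp only [ENNReal.coe_one, ENNReal.one_rpow, one_mul] at this
  exact hpos.trans_le ((measure_mono hsub).trans this)

lemma side_dichotomy {n : ℕ} (hn : 2 ≤ n) (hn0 : 0 < n) {γ : ℝ → ℝ} (hγ : Measurable γ)
    (hfin : μH[(n:ℝ) - 1] (essBoundary (Fset γ (e1 n hn0))) < ⊤)
    {rb : ℝ} (hrb : 0 < rb) {I : Set ℝ} (hI : I = Iio rb ∨ I = Ioi rb)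
    {k1 k2 : ℝ} (h1 : -1 ≤ k1) (h12 : k1 < k2) (h2 : k2 ≤ 1) :
    RDensity0 ({s | γ s < k1} ∩ I) rb ∨ RDensity0 ({s | k2 < γ s} ∩ I) rb := by
  by_contra hcon
  rw [not_or] at hcon
  set p := e1 n hn0 with hp
  have hp1 : ‖p‖ = 1 := norm_e1 _
  set T := {ω : Euc n | ‖ω‖ = 1 ∧ k1 < ⟪ω, p⟫ ∧ ⟪ω, p⟫ < k2} with hT
  have hTpos : 0 < μH[(n:ℝ) - 1] T := zone_pos hn hn0 h1 h12 h2
  have hIm : MeasurableSet I := by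
    rcases hI with rfl | rfl
    · exact measurableSet_Iio
    · exact measurableSet_Ioi
  have hJ : ∀ ε : ℝ, ∃ c d, I ∩ ball rb ε = Ioo c d := by
    intro ε
    rw [Real.ball_eq_Ioo]
    rcases hI with rfl | rfl
    · refine ⟨rb - ε, min rb (rb + ε), ?_⟩
      ext s; simp only [mem_inter_iff, mem_Iio, mem_Ioo, lt_min_iff]; tauto
    · refine ⟨max rb (rb - ε), rb + ε, ?_⟩
      ext s; simp only [mem_inter_iff, mem_Ioi, mem_Ioo, max_lt_iff]; tauto
  have hIrb : rb ∉ I := by rcases hI with rfl | rfl <;> simp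
  have ha : ∀ ε : ℝ, 0 < ε → ε ≤ rb/2 → ∀ ω ∈ T, ∃ r ∈ I ∩ ball rb ε,
      r • ω ∈ essBoundary (Fset γ p) := by
    intro ε hε hεr ω ⟨hω, hk1, hk2⟩
    by_contra hno
    push Not at hno
    obtain ⟨c, d, hcd⟩ := hJ ε
    have hA : MeasurableSet {s | γ s < ⟪ω, p⟫} := measurableSet_lt hγ measurable_const
    have key := trivial_of_density (c := c) (d := d) hA (fun r hr => by
      rw [← hcd] at hr
      refine core hn hγ hp1 hω ?_ ?_ (hno r hr)
      · rw [abs_lt]; constructor <;> linarith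
      · have := hr.2
        rw [Real.ball_eq_Ioo] at this
        linarith [this.1])
    rw [← hcd] at key
    rcases key with key | key
    · refine hcon.1 (rdensity0_of_null_near hε (measure_mono_null ?_ key))
      rintro s ⟨⟨hs1, hs2⟩, hs3⟩
      exact ⟨lt_trans hs1 hk1, hs2, hs3⟩
    · refine hcon.2 (rdensity0_of_null_near hε (measure_mono_null ?_ key))
      rintro s ⟨⟨hs1, hs2⟩, hs3⟩
      refine ⟨?_, hs2, hs3⟩
      simp only [mem_compl_iff, mem_ofPred_eq, not_lt] at hs1 ⊢
      linarith
  set K : ℝ≥0 := ⟨4/rb, by positivity⟩ with hK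
  set S : ℕ → Set (Euc n) := fun j => {x | ‖x‖ ∈ I ∩ ball rb (rb/2/((j:ℝ)+1))} with hS
  have hSm : ∀ j, MeasurableSet (S j) := fun j =>
    measurable_norm (hIm.inter measurableSet_ball)
  have hεle : ∀ j : ℕ, rb/2/((j:ℝ)+1) ≤ rb/2 := fun j =>
    div_le_self (by positivity) (by have : (0:ℝ) ≤ j := Nat.cast_nonneg j
                                    linarith)
  set ν := (μH[(n:ℝ) - 1] : Measure (Euc n)).restrict (essBoundary (Fset γ p)) with hν
  have hd0 : (0:ℝ) ≤ (n:ℝ) - 1 := by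
    have : (2:ℝ) ≤ n := by exact_mod_cast hn
    linarith
  have hb : ∀ j, μH[(n:ℝ) - 1] T ≤ (K:ℝ≥0∞) ^ ((n:ℝ) - 1) * ν (S j) := by
    intro j
    have hlip : LipschitzOnWith K (hatv : Euc n → Euc n) (S j ∩ essBoundary (Fset γ p)) := by
      refine LipschitzOnWith.of_dist_le_mul ?_
      rintro x ⟨⟨_, hx⟩, _⟩ y ⟨⟨_, hy⟩, _⟩
      rw [Real.ball_eq_Ioo] at hy
      have hy2 : rb/2 ≤ ‖y‖ := by linarith [hy.1, hεle j]
      have hy0 : y ≠ 0 := norm_pos_iff.1 (by linarith)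
      rw [dist_eq_norm, dist_eq_norm]
      refine (hatv_sub_le hy0).trans ?_
      gcongr
      change 2 / ‖y‖ ≤ 4/rb
      rw [div_le_div_iff₀ (by linarith) hrb]
      linarith
    have := hlip.hausdorffMeasure_image_le hd0
    rw [hν, Measure.restrict_apply (hSm j)]
    refine le_trans (measure_mono ?_) this
    intro ω hω
    obtain ⟨r, hr, hre⟩ := ha (rb/2/((j:ℝ)+1)) (by positivity) (hεle j) ω hω
    have hr0 : 0 < r := by
      have := hr.2
      rw [Real.ball_eq_Ioo] at this
      linarith [this.1, hεle j]
    refine ⟨r • ω, ⟨?_, hre⟩, hatv_smul_unit hω.1 hr0⟩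
    change ‖r • ω‖ ∈ I ∩ ball rb (rb/2/((j:ℝ)+1))
    rw [norm_smul, hω.1, mul_one, Real.norm_eq_abs, abs_of_pos hr0]
    exact hr
  have hfinν : IsFiniteMeasure ν := ⟨by rw [hν, Measure.restrict_apply_univ]; exact hfin⟩
  have hanti : Antitone S := by
    intro i j hij x hx
    refine ⟨hx.1, ball_subset_ball ?_ hx.2⟩
    have : (i:ℝ) ≤ j := by exact_mod_cast hij
    gcongr
  have hempty : ⋂ j, S j = ∅ := by
    rw [eq_empty_iff_forall_notMem]
    intro x hx
    rw [mem_iInter] at hx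
    have hne : ‖x‖ ≠ rb := fun h => hIrb (h ▸ (hx 0).1)
    have hlim : Tendsto (fun j : ℕ => rb/2/((j:ℝ)+1)) atTop (𝓝 0) :=
      tendsto_const_nhds.div_atTop (tendsto_atTop_add_const_right _ _ tendsto_natCast_atTop_atTop)
    have hle : dist ‖x‖ rb ≤ 0 := ge_of_tendsto' hlim fun j => (hx j).2.le
    exact hne (dist_le_zero.1 hle)
  have ht := tendsto_measure_iInter_atTop (μ := ν) (fun j => (hSm j).nullMeasurableSet) hanti
    ⟨0, measure_ne_top _ _⟩
  rw [hempty, measure_empty] at ht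
  have ht2 := ENNReal.Tendsto.const_mul (a := (K:ℝ≥0∞) ^ ((n:ℝ) - 1)) ht
    (Or.inr (ENNReal.rpow_ne_top_of_nonneg hd0 ENNReal.coe_ne_top))
  rw [mul_zero] at ht2
  exact absurd (ge_of_tendsto' ht2 hb) (not_le.2 hTpos)

lemma not_rdensity0_univ (x : ℝ) : ¬ RDensity0 univ x := by
  rw [rdensity0_iff]
  intro h
  have h2 := (h 1 one_pos).and self_mem_nhdsWithin
  obtain ⟨ρ, hρ, hρ0⟩ := h2.exists
  rw [univ_inter, Real.volume_real_ball hρ0.le] at hρ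
  linarith

lemma apInf_bdd {α : ℝ → ℝ} (hα : ∀ r, α r ∈ Icc (0:ℝ) Real.pi) (x : ℝ) :
    BddAbove {t : ℝ | RDensity0 {y | α y < t} x} := by
  refine ⟨Real.pi, fun t ht => ?_⟩
  by_contra hlt
  rw [not_le] at hlt
  have : {y | α y < t} = univ := eq_univ_of_forall fun y => (hα y).2.trans_lt hlt
  rw [mem_ofPred_eq, this] at ht
  exact not_rdensity0_univ x ht

lemma apSup_bdd {α : ℝ → ℝ} (hα : ∀ r, α r ∈ Icc (0:ℝ) Real.pi) (x : ℝ) :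
    BddBelow {t : ℝ | RDensity0 {y | t < α y} x} := by
  refine ⟨0, fun t ht => ?_⟩
  by_contra hlt
  rw [not_le] at hlt
  have : {y | t < α y} = univ := eq_univ_of_forall fun y => hlt.trans_le (hα y).1
  rw [mem_ofPred_eq, this] at ht
  exact not_rdensity0_univ x ht

lemma lt_cos_iff {a κ : ℝ} (ha : a ∈ Icc (0:ℝ) Real.pi) (h1 : -1 ≤ κ) (h2 : κ ≤ 1) :
    κ < Real.cos a ↔ a < Real.arccos κ := by
  conv_lhs => rw [← Real.cos_arccos h1 h2]
  exact Real.strictAntiOn_cos.lt_iff_gt ⟨Real.arccos_nonneg _, Real.arccos_le_pi _⟩ ha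

lemma cos_lt_iff {a κ : ℝ} (ha : a ∈ Icc (0:ℝ) Real.pi) (h1 : -1 ≤ κ) (h2 : κ ≤ 1) :
    Real.cos a < κ ↔ Real.arccos κ < a := by
  conv_lhs => rw [← Real.cos_arccos h1 h2]
  exact Real.strictAntiOn_cos.lt_iff_gt ha ⟨Real.arccos_nonneg _, Real.arccos_le_pi _⟩

lemma side_choice {S : ℝ → Set ℝ} (hS : Antitone S) {rb : ℝ}
    (h : ∀ κ ∈ Ioo (-1:ℝ) 1, ¬ RDensity0 (S κ) rb) :
    ∃ I : Set ℝ, (I = Iio rb ∨ I = Ioi rb) ∧ ∀ κ ∈ Ioo (-1:ℝ) 1, ¬ RDensity0 (S κ ∩ I) rb := by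
  by_contra hno
  push Not at hno
  obtain ⟨κ1, h1, d1⟩ := hno (Iio rb) (Or.inl rfl)
  obtain ⟨κ2, h2, d2⟩ := hno (Ioi rb) (Or.inr rfl)
  refine h (max κ1 κ2) ⟨lt_max_of_lt_left h1.1, max_lt h1.2 h2.2⟩ ?_
  have h3 : RDensity0 {rb} rb :=
    rdensity0_of_null_near one_pos (measure_mono_null inter_subset_left (by simp))
  refine (RDensity0.union (RDensity0.union d1 d2) h3).mono ?_
  intro s hs
  rcases lt_trichotomy s rb with hlt | heq | hgt
  · exact Or.inr (Or.inr ⟨hS (le_max_left _ _) hs, hlt⟩)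
  · exact Or.inl heq
  · exact Or.inr (Or.inl ⟨hS (le_max_right _ _) hs, hgt⟩)

lemma continuousAt_hatv {n : ℕ} {x : Euc n} (hx : x ≠ 0) : ContinuousAt (hatv : Euc n → Euc n) x :=
  (continuousAt_id.norm.inv₀ (norm_ne_zero_iff.2 hx)).smul continuousAt_id

lemma eq_smul_of_inner {n : ℕ} {x p : Euc n} (hx : x ≠ 0) (hp : ‖p‖ = 1)
    (h : ⟪hatv x, p⟫ = (1:ℝ)) : x = ‖x‖ • p := by
  have := (inner_eq_one_iff_of_norm_eq_one (𝕜 := ℝ) (norm_hatv hx) hp).1 h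
  rw [← this, smul_hatv]

lemma inner_hatv_le {n : ℕ} {x p : Euc n} (hx : x ≠ 0) (hp : ‖p‖ = 1) :
    |⟪hatv x, p⟫| ≤ (1:ℝ) := by
  have := abs_real_inner_le_norm (hatv x) p
  rwa [norm_hatv hx, hp, mul_one] at this

lemma side_exists {n : ℕ} (hn : 2 ≤ n) (hn0 : 0 < n) {α : ℝ → ℝ} (hαm : Measurable α)
    (hα : ∀ r, α r ∈ Icc (0:ℝ) Real.pi) {γ : ℝ → ℝ} (hγ : γ = fun r => Real.cos (α r))
    (hfin : μH[(n:ℝ) - 1] (essBoundary (Fset γ (e1 n hn0))) < ⊤)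
    {rb : ℝ} (hrb : 0 < rb) (hdeg : apInf α rb = 0 ∨ apSup α rb = Real.pi) :
    ∃ I : Set ℝ, (I = Iio rb ∨ I = Ioi rb) ∧ ∃ q : Euc n,
      ((∀ x, ‖x‖ = rb → x ≠ q → DensityAt (Fset γ (e1 n hn0) ∩ {y | ‖y‖ ∈ I}) x 0) ∨
       (∀ x, ‖x‖ = rb → x ≠ q → DensityAt ((Fset γ (e1 n hn0))ᶜ ∩ {y | ‖y‖ ∈ I}) x 0)) := by
  have hγm : Measurable γ := by rw [hγ]; exact Real.measurable_cos.comp hαm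
  set p := e1 n hn0 with hp
  have hp1 : ‖p‖ = 1 := norm_e1 _
  have hImeas : ∀ I : Set ℝ, (I = Iio rb ∨ I = Ioi rb) → MeasurableSet I := by
    rintro I (rfl | rfl)
    · exact measurableSet_Iio
    · exact measurableSet_Ioi
  rcases hdeg with hdeg | hdeg
  · have h0 : ∀ κ ∈ Ioo (-1:ℝ) 1, ¬ RDensity0 {s | κ < γ s} rb := by
      intro κ hκ hd
      have he : {s | κ < γ s} = {s | α s < Real.arccos κ} := by
        ext s; rw [hγ]; exact lt_cos_iff (hα s) hκ.1.le hκ.2.le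
      rw [he] at hd
      have hle : Real.arccos κ ≤ apInf α rb := le_csSup (apInf_bdd hα rb) hd
      rw [hdeg] at hle
      exact absurd hle (not_le.2 (Real.arccos_pos.2 hκ.2))
    obtain ⟨I, hI, hside⟩ := side_choice (S := fun κ => {s | κ < γ s})
      (fun a b hab s hs => lt_of_le_of_lt hab hs) h0
    refine ⟨I, hI, rb • p, Or.inl ?_⟩
    intro x hx hxq
    have hx0 : x ≠ 0 := norm_pos_iff.1 (hx ▸ hrb)
    have hlt : ⟪hatv x, p⟫ < (1:ℝ) := by
      refine lt_of_le_of_ne (abs_le.1 (inner_hatv_le hx0 hp1)).2 fun h => hxq ?_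
      rw [← hx]; exact eq_smul_of_inner hx0 hp1 h
    have hge := (abs_le.1 (inner_hatv_le hx0 hp1)).1
    set κ := (⟪hatv x, p⟫ + 1)/2 with hκ
    have hR : RDensity0 ({s | γ s < κ} ∩ I) rb := by
      rcases side_dichotomy hn hn0 hγm hfin hrb hI (k1 := κ) (k2 := (κ+1)/2) (by linarith) (by linarith)
        (by linarith) with h | h
      · exact h
      · exact absurd h (hside _ ⟨by linarith, by linarith⟩)
    refine density0_of_rdensity0 hn ((measurableSet_lt hγm measurable_const).inter (hImeas I hI)) hx0
      (U := {y | ⟪hatv y, p⟫ < κ}) ?_ ?_ (hx ▸ hR)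
    · have hc : ContinuousAt (fun y => ⟪hatv y, p⟫) x := (continuousAt_hatv hx0).inner continuousAt_const
      exact hc.eventually_lt_const (by linarith)
    · rintro y ⟨⟨hy1, hy2⟩, hy3⟩
      exact ⟨lt_trans hy1.2 hy3, hy2⟩
  · have h0 : ∀ κ ∈ Ioo (-1:ℝ) 1, ¬ RDensity0 {s | γ s < -κ} rb := by
      intro κ hκ hd
      have he : {s | γ s < -κ} = {s | Real.arccos (-κ) < α s} := by
        ext s; rw [hγ]; exact cos_lt_iff (hα s) (by linarith [hκ.2]) (by linarith [hκ.1])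
      rw [he] at hd
      have hle : apSup α rb ≤ Real.arccos (-κ) := csInf_le (apSup_bdd hα rb) hd
      rw [hdeg, Real.arccos_neg] at hle
      have := Real.arccos_pos.2 hκ.2
      linarith
    obtain ⟨I, hI, hside⟩ := side_choice (S := fun κ => {s | γ s < -κ})
      (fun a b hab s hs => lt_of_lt_of_le hs (neg_le_neg hab)) h0
    refine ⟨I, hI, -(rb • p), Or.inr ?_⟩
    intro x hx hxq
    have hx0 : x ≠ 0 := norm_pos_iff.1 (hx ▸ hrb)
    have hle := (abs_le.1 (inner_hatv_le hx0 hp1)).2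
    have hgt : (-1:ℝ) < ⟪hatv x, p⟫ := by
      refine lt_of_le_of_ne (abs_le.1 (inner_hatv_le hx0 hp1)).1 fun h => hxq ?_
      have h5 := eq_smul_of_inner (p := -p) hx0 (by rw [norm_neg, hp1])
        (by rw [inner_neg_right, ← h]; norm_num)
      rw [h5, hx, smul_neg]
    set κ := (⟪hatv x, p⟫ - 1)/2 with hκ
    have hR : RDensity0 ({s | κ < γ s} ∩ I) rb := by
      rcases side_dichotomy hn hn0 hγm hfin hrb hI (k1 := (κ-1)/2) (k2 := κ) (by linarith) (by linarith)
        (by linarith) with h | h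
      · refine absurd ?_ (hside (-((κ-1)/2)) ⟨by linarith, by linarith⟩)
        rw [neg_neg]; exact h
      · exact h
    refine density0_of_rdensity0 hn ((measurableSet_lt measurable_const hγm).inter (hImeas I hI)) hx0
      (U := {y | κ < ⟪hatv y, p⟫} ∩ {0}ᶜ) ?_ ?_ (hx ▸ hR)
    · have hc : ContinuousAt (fun y => ⟪hatv y, p⟫) x := (continuousAt_hatv hx0).inner continuousAt_const
      exact inter_mem (hc.eventually_const_lt (by linarith)) (isOpen_compl_singleton.mem_nhds hx0)
    · rintro y ⟨⟨hy1, hy2⟩, hy3, hy4⟩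
      refine ⟨?_, hy2⟩
      have : ¬ γ ‖y‖ < ⟪hatv y, p⟫ := fun h => hy1 ⟨hy4, h⟩
      exact lt_of_lt_of_le hy3 (not_lt.1 this)

lemma hausdorff_image {n : ℕ} (R : Euc n ≃ₗᵢ[ℝ] Euc n) (d : ℝ) (A : Set (Euc n)) :
    μH[d] (R '' A) = μH[d] A :=
  R.isometry.hausdorffMeasure_image (Or.inr R.surjective) A

lemma density0_of_null {n : ℕ} {Z : Set (Euc n)} (hZ : volume Z = 0) (x : Euc n) :
    DensityAt Z x 0 := by
  have : ∀ ρ : ℝ, volume (Z ∩ ball x ρ) / volume (ball x ρ) = 0 := fun ρ => by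
    rw [measure_mono_null inter_subset_left hZ, ENNReal.zero_div]
  unfold DensityAt
  simp only [this]
  exact tendsto_const_nhds

lemma density0_union_null {n : ℕ} {D Z : Set (Euc n)} (hZ : volume Z = 0) {x : Euc n}
    (hD : DensityAt D x 0) : DensityAt (D ∪ Z) x 0 := by
  refine density_congr ENNReal.zero_ne_top ((density0_of_null hZ x).mono ?_) hD
  rintro y (⟨h1, h2⟩ | ⟨h1, h2⟩)
  · exact absurd (Or.inl h1) h2
  · exact h1.resolve_left h2

lemma sphere_null {n : ℕ} {r : ℝ} (hr : 0 < r) : volume (sphere (0 : Euc n) r) = 0 :=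
  Measure.addHaar_sphere_of_ne_zero _ _ hr.ne'

lemma hausdorff_part_congr {n : ℕ} (hn : 2 ≤ n) {X Y S : Set (Euc n)} {N : Set (Euc n)}
    (hN : N.Finite) (h : ∀ x ∈ S, x ∉ N → (x ∈ X ↔ x ∈ Y)) :
    μH[(n:ℝ) - 1] (X ∩ S) = μH[(n:ℝ) - 1] (Y ∩ S) := by
  have hd0 : (0:ℝ) < (n:ℝ) - 1 := by
    have : (2:ℝ) ≤ n := by exact_mod_cast hn
    linarith
  have := Measure.nullSingletonClass_hausdorff (Euc n) hd0
  have hN0 : μH[(n:ℝ) - 1] N = 0 := hN.measure_zero _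
  have key : ∀ X Y : Set (Euc n), (∀ x ∈ S, x ∉ N → (x ∈ X ↔ x ∈ Y)) →
      μH[(n:ℝ) - 1] (X ∩ S) ≤ μH[(n:ℝ) - 1] (Y ∩ S) := by
    intro X Y h
    have h3 : μH[(n:ℝ) - 1] (X ∩ S) ≤ μH[(n:ℝ) - 1] ((Y ∩ S) ∪ N) := by
      refine measure_mono ?_
      rintro x ⟨hx, hxS⟩
      by_cases hxN : x ∈ N
      · exact Or.inr hxN
      · exact Or.inl ⟨(h x hxS hxN).1 hx, hxS⟩
    refine (h3.trans (measure_union_le _ _)).trans ?_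
    rw [hN0, add_zero]
  exact le_antisymm (key X Y h) (key Y X fun x hx hxN => (h x hx hxN).symm)

lemma measure_split {n : ℕ} (μ : Measure (Euc n)) (r : ℝ) (A : Set (Euc n)) :
    μ A = μ (A ∩ ball 0 r) + μ (A ∩ sphere 0 r) + μ (A ∩ (closedBall 0 r)ᶜ) := by
  rw [← measure_inter_add_sdiff A (measurableSet_closedBall (x := (0 : Euc n)) (ε := r)),
    ← measure_inter_add_sdiff (A ∩ closedBall 0 r) (measurableSet_ball (x := (0 : Euc n)) (ε := r))]
  congr 2
  · congr 1
    rw [inter_assoc, inter_eq_self_of_subset_right ball_subset_closedBall]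
  · congr 1
    ext y
    simp only [Set.mem_sdiff, mem_inter_iff, mem_closedBall, mem_ball, mem_sphere, not_lt]
    constructor
    · rintro ⟨⟨h1, h2⟩, h3⟩; exact ⟨h1, le_antisymm h2 h3⟩
    · rintro ⟨h1, h2⟩; exact ⟨⟨h1, h2.le⟩, h2.ge⟩

lemma image_union_inter_ball {n : ℕ} (R : Euc n ≃ₗᵢ[ℝ] Euc n) (F : Set (Euc n)) (r : ℝ) :
    R '' (F \ ball 0 r) = (R '' F) \ ball 0 r := by
  rw [image_sdiff R.injective, R.image_ball, map_zero]

lemma perim_eq {n : ℕ} (hn : 2 ≤ n) {F : Set (Euc n)} {rb : ℝ} (hrb : 0 < rb)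
    {I : Set ℝ} (hI : I = Iio rb ∨ I = Ioi rb) {q : Euc n}
    (hside : (∀ x, ‖x‖ = rb → x ≠ q → DensityAt (F ∩ {y | ‖y‖ ∈ I}) x 0) ∨
       (∀ x, ‖x‖ = rb → x ≠ q → DensityAt (Fᶜ ∩ {y | ‖y‖ ∈ I}) x 0))
    (R : Euc n ≃ₗᵢ[ℝ] Euc n) :
    μH[(n:ℝ) - 1] (essBoundary ((F ∩ ball 0 rb) ∪ R '' (F \ ball 0 rb))) =
      μH[(n:ℝ) - 1] (essBoundary F) := by
  rw [image_union_inter_ball]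
  set B := ball (0 : Euc n) rb with hB
  set G := R '' F with hG
  set E := (F ∩ B) ∪ (G \ B) with hE
  have hnull := sphere_null (n := n) hrb
  have hRB : R '' B = B := by rw [hB, R.image_ball, map_zero]
  have hRS : R '' sphere 0 rb = sphere 0 rb := by rw [R.image_sphere, map_zero]
  have hRC : R '' closedBall 0 rb = closedBall 0 rb := by rw [R.image_closedBall, map_zero]
  rw [measure_split _ rb (essBoundary E), measure_split _ rb (essBoundary F)]
  have hsph : μH[(n:ℝ) - 1] (essBoundary E ∩ sphere 0 rb) =
      μH[(n:ℝ) - 1] (essBoundary F ∩ sphere 0 rb) := by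
    rcases hI with rfl | rfl
    · have hset : {y : Euc n | ‖y‖ ∈ Iio rb} = B := by ext y; simp [hB]
      rw [hset] at hside
      have fin : ∀ X : Set (Euc n), ∀ D : Set (Euc n),
          (∀ x, ‖x‖ = rb → x ≠ q → DensityAt D x 0) → symmDiff F X ⊆ D →
          symmDiff E (R '' X) ⊆ D → μH[(n:ℝ) - 1] (essBoundary E ∩ sphere 0 rb) =
            μH[(n:ℝ) - 1] (essBoundary F ∩ sphere 0 rb) := by
        intro X D hD h1 h2
        have e1 : μH[(n:ℝ) - 1] (essBoundary E ∩ sphere 0 rb) =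
            μH[(n:ℝ) - 1] (essBoundary (R '' X) ∩ sphere 0 rb) :=
          hausdorff_part_congr hn (finite_singleton q) fun x hx hxN =>
            mem_essBoundary_congr ((hD x (mem_sphere_zero_iff_norm.1 hx) hxN).mono h2)
        have e2 : μH[(n:ℝ) - 1] (essBoundary F ∩ sphere 0 rb) =
            μH[(n:ℝ) - 1] (essBoundary X ∩ sphere 0 rb) :=
          hausdorff_part_congr hn (finite_singleton q) fun x hx hxN =>
            mem_essBoundary_congr ((hD x (mem_sphere_zero_iff_norm.1 hx) hxN).mono h1)
        rw [e1, e2, essBoundary_image]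
        conv_lhs => rw [← hRS]
        rw [← image_inter R.injective, hausdorff_image]
      rcases hside with hside | hside
      · refine fin (F \ B) _ hside ?_ ?_
        · rintro y (⟨h1, h2⟩ | ⟨h1, h2⟩)
          · exact ⟨h1, by_contra fun h => h2 ⟨h1, h⟩⟩
          · exact absurd h1.1 h2
        · rw [image_union_inter_ball]
          rintro y (⟨h1, h2⟩ | ⟨h1, h2⟩)
          · exact h1.resolve_right h2
          · exact absurd (Or.inr h1) h2
      · refine fin ((F \ B) ∪ B) _ hside ?_ ?_
        · rintro y (⟨h1, h2⟩ | ⟨h1, h2⟩)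
          · exact absurd (by by_cases h : y ∈ B
                             · exact Or.inr h
                             · exact Or.inl ⟨h1, h⟩) h2
          · exact ⟨h2, h1.resolve_left fun h => h2 h.1⟩
        · rw [image_union, image_union_inter_ball, hRB]
          rintro y (⟨h1, h2⟩ | ⟨h1, h2⟩)
          · rcases h1 with h1 | h1
            · exact absurd (Or.inr h1.2) h2
            · exact absurd (Or.inl h1) h2
          · have hyB : y ∈ B := h1.resolve_left fun h => h2 (Or.inr h)
            exact ⟨fun h => h2 (Or.inl ⟨h, hyB⟩), hyB⟩
    · have fin : ∀ X : Set (Euc n), ∀ D : Set (Euc n),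
          (∀ x, ‖x‖ = rb → x ≠ q → DensityAt D x 0) → symmDiff F X ⊆ D ∪ sphere 0 rb →
          symmDiff E X ⊆ R '' (D ∪ sphere 0 rb) → μH[(n:ℝ) - 1] (essBoundary E ∩ sphere 0 rb) =
            μH[(n:ℝ) - 1] (essBoundary F ∩ sphere 0 rb) := by
        intro X D hD h1 h2
        have e1 : μH[(n:ℝ) - 1] (essBoundary E ∩ sphere 0 rb) =
            μH[(n:ℝ) - 1] (essBoundary X ∩ sphere 0 rb) := by
          refine hausdorff_part_congr hn (finite_singleton (R q)) fun x hx hxN => ?_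
          obtain ⟨z, rfl⟩ := R.surjective x
          have hz : ‖z‖ = rb := by rw [← mem_sphere_zero_iff_norm.1 hx, R.norm_map]
          have hzq : z ≠ q := fun h => hxN (by rw [h]; rfl)
          refine mem_essBoundary_congr (DensityAt.mono ?_ h2)
          rw [density_image]
          exact density0_union_null hnull (hD z hz hzq)
        have e2 : μH[(n:ℝ) - 1] (essBoundary F ∩ sphere 0 rb) =
            μH[(n:ℝ) - 1] (essBoundary X ∩ sphere 0 rb) :=
          hausdorff_part_congr hn (finite_singleton q) fun x hx hxN =>
            mem_essBoundary_congr ((density0_union_null hnull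
              (hD x (mem_sphere_zero_iff_norm.1 hx) hxN)).mono h1)
        rw [e1, e2]
      have hout : ∀ y : Euc n, y ∉ B → ‖y‖ ∈ Ioi rb ∨ y ∈ sphere 0 rb := by
        intro y hy
        rw [hB, mem_ball, dist_zero_right, not_lt] at hy
        rcases hy.lt_or_eq with h | h
        · exact Or.inl h
        · exact Or.inr (mem_sphere_zero_iff_norm.2 h.symm)
      have hRout : ∀ y : Euc n, R y ∉ B → y ∉ B := by
        intro y hy h
        apply hy
        rw [hB, mem_ball, dist_zero_right] at h ⊢
        rwa [R.norm_map]
      rcases hside with hside | hside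
      · refine fin (F ∩ B) _ hside ?_ ?_
        · rintro y (⟨h1, h2⟩ | ⟨h1, h2⟩)
          · have hy : y ∉ B := fun h => h2 ⟨h1, h⟩
            exact (hout y hy).imp (fun h => ⟨h1, h⟩) id
          · exact absurd h1.1 h2
        · rintro y (⟨h1, h2⟩ | ⟨h1, h2⟩)
          · obtain ⟨⟨z, hz, rfl⟩, h4⟩ := h1.resolve_left h2
            exact ⟨z, (hout z (hRout z h4)).imp (fun h => ⟨hz, h⟩) id, rfl⟩
          · exact absurd (Or.inl h1) h2
      · refine fin ((F ∩ B) ∪ Bᶜ) _ hside ?_ ?_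
        · rintro y (⟨h1, h2⟩ | ⟨h1, h2⟩)
          · exact absurd (by by_cases h : y ∈ B
                             · exact Or.inl ⟨h1, h⟩
                             · exact Or.inr h) h2
          · have hy : y ∉ B := h1.resolve_left fun h => h2 h.1
            exact (hout y hy).imp (fun h => ⟨h2, h⟩) id
        · rintro y (⟨h1, h2⟩ | ⟨h1, h2⟩)
          · rcases h1 with h1 | h1
            · exact absurd (Or.inl h1) h2
            · exact absurd (Or.inr h1.2) h2
          · have hy : y ∉ B := h1.resolve_left fun h => h2 (Or.inl h)
            obtain ⟨z, rfl⟩ := R.surjective y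
            have hz : z ∉ F := fun h => h2 (Or.inr ⟨⟨z, h, rfl⟩, hy⟩)
            exact ⟨z, (hout z (hRout z hy)).imp (fun h => ⟨hz, h⟩) id, rfl⟩
  have hin : essBoundary E ∩ B = essBoundary F ∩ B := by
    ext x
    simp only [mem_inter_iff]
    refine and_congr_left fun hx => ?_
    refine mem_essBoundary_congr_local (isOpen_ball.mem_nhds hx) ?_
    ext y
    constructor
    · rintro ⟨h1 | h1, h2⟩
      · exact ⟨h1.1, h2⟩
      · exact absurd h2 h1.2
    · rintro ⟨h1, h2⟩
      exact ⟨Or.inl ⟨h1, h2⟩, h2⟩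
  have hC : essBoundary E ∩ (closedBall 0 rb)ᶜ = R '' (essBoundary F ∩ (closedBall 0 rb)ᶜ) := by
    rw [image_inter R.injective, image_compl_eq R.bijective, hRC, ← essBoundary_image]
    ext x
    simp only [mem_inter_iff]
    refine and_congr_left fun hx => ?_
    refine mem_essBoundary_congr_local (isClosed_closedBall.isOpen_compl.mem_nhds hx) ?_
    ext y
    constructor
    · rintro ⟨h1 | h1, h2⟩
      · exact absurd (ball_subset_closedBall h1.2) h2
      · exact ⟨h1.1, h2⟩
    · rintro ⟨h1, h2⟩
      exact ⟨Or.inr ⟨h1, fun h => h2 (ball_subset_closedBall h)⟩, h2⟩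
  rw [hsph, hin, hC, hausdorff_image]

lemma pos_radii {α : ℝ → ℝ} (hα : ∀ r, α r ∈ Icc (0:ℝ) Real.pi) {r1 : ℝ} {O : Set ℝ}
    (hO : O ∈ 𝓝 r1) (h1 : 0 < apInf α r1) (h2 : apSup α r1 < Real.pi) :
    volume (O ∩ {r | 0 < α r ∧ α r < Real.pi}) ≠ 0 := by
  intro hnull
  obtain ⟨t, ht, ht0⟩ : ∃ t, RDensity0 {y | α y < t} r1 ∧ 0 < t := by
    have hne : {t : ℝ | RDensity0 {y | α y < t} r1}.Nonempty := by
      by_contra hne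
      rw [not_nonempty_iff_eq_empty] at hne
      rw [apInf, hne, Real.sSup_empty] at h1
      exact lt_irrefl _ h1
    exact exists_lt_of_lt_csSup hne h1
  obtain ⟨t', ht', ht'0⟩ : ∃ t, RDensity0 {y | t < α y} r1 ∧ t < Real.pi := by
    have hne : {t : ℝ | RDensity0 {y | t < α y} r1}.Nonempty := by
      refine ⟨Real.pi, rdensity0_of_null_near one_pos ?_⟩
      have : {y | Real.pi < α y} = ∅ := by
        ext y; simpa using (hα y).2
      simp [this]
    exact exists_lt_of_csInf_lt hne h2
  have h3 : RDensity0 (O ∩ {r | 0 < α r ∧ α r < Real.pi}) r1 :=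
    rdensity0_of_null_near one_pos (measure_mono_null inter_subset_left hnull)
  have h4 : RDensity0 Oᶜ r1 := by
    obtain ⟨ε, hε, hb⟩ := Metric.mem_nhds_iff.1 hO
    refine rdensity0_of_null_near hε ?_
    have : Oᶜ ∩ ball r1 ε = ∅ := by
      ext y
      simp only [mem_inter_iff, mem_compl_iff, mem_empty_iff_false, iff_false, not_and]
      exact fun h h' => h (hb h')
    rw [this, measure_empty]
  refine not_rdensity0_univ r1 (((ht.union ht').union (h3.union h4)).mono ?_)
  intro y _
  by_cases hyO : y ∈ O
  · by_cases hy1 : α y < t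
    · exact Or.inr (Or.inr hy1)
    · by_cases hy2 : t' < α y
      · exact Or.inr (Or.inl hy2)
      · exact Or.inl (Or.inr ⟨hyO, by linarith, by linarith⟩)
  · exact Or.inl (Or.inl hyO)

lemma exists_between_dir {n : ℕ} {p q : Euc n} (hp : ‖p‖ = 1) (hq : ‖q‖ = 1) (hpq : p ≠ q)
    {c : ℝ} (hc1 : -1 < c) (hc2 : c < 1) :
    ∃ ω : Euc n, ‖ω‖ = 1 ∧ ⟪ω, q⟫ < c ∧ c < ⟪ω, p⟫ := by
  have hpp : ⟪p, p⟫ = (1:ℝ) := by rw [real_inner_self_eq_norm_sq, hp]; norm_num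
  have hqq : ⟪q, q⟫ = (1:ℝ) := by rw [real_inner_self_eq_norm_sq, hq]; norm_num
  have hlt : ⟪p, q⟫ < (1:ℝ) := by
    refine lt_of_le_of_ne ?_ fun h => hpq ((inner_eq_one_iff_of_norm_eq_one (𝕜 := ℝ) hp hq).1 h)
    have := real_inner_le_norm p q
    rwa [hp, hq, mul_one] at this
  suffices h : ∃ x : Euc n, x ≠ 0 ∧ ⟪x, q⟫ < c * ‖x‖ ∧ c * ‖x‖ < ⟪x, p⟫ by
    obtain ⟨x, hx, h1, h2⟩ := h
    have hx0 : 0 < ‖x‖ := norm_pos_iff.2 hx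
    refine ⟨hatv x, norm_hatv hx, ?_, ?_⟩
    · rw [hatv, real_inner_smul_left, inv_mul_lt_iff₀ hx0, mul_comm]; exact h1
    · rw [hatv, real_inner_smul_left, lt_inv_mul_iff₀ hx0, mul_comm]; exact h2
  set H : Set (Euc n) := {x | 0 < ⟪x, p - q⟫} with hH
  have hconv : Convex ℝ H := by
    intro x hx y hy a b ha hb hab
    have hx' : 0 < ⟪x, p - q⟫ := hx
    have hy' : 0 < ⟪y, p - q⟫ := hy
    change 0 < ⟪a • x + b • y, p - q⟫
    rw [inner_add_left, real_inner_smul_left, real_inner_smul_left]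
    rcases ha.eq_or_lt with h | h
    · have : b = 1 := by linarith
      rw [← h, this]; linarith
    · have := mul_pos h hx'
      have := mul_nonneg hb hy'.le
      linarith
  have hpH : p ∈ H := by
    change 0 < ⟪p, p - q⟫
    rw [inner_sub_right, hpp]; linarith
  have hqH : -q ∈ H := by
    change 0 < ⟪-q, p - q⟫
    rw [inner_neg_left, inner_sub_right, hqq, real_inner_comm]; linarith
  have hH0 : ∀ x ∈ H, x ≠ 0 := by
    rintro x hx rfl
    have : 0 < ⟪(0 : Euc n), p - q⟫ := hx
    rw [inner_zero_left] at this
    exact lt_irrefl _ this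
  let φ : Euc n → ℝ := fun x => (⟪x, p⟫ + ⟪x, q⟫) - 2 * (c * ‖x‖)
  have hφ : Continuous φ := by fun_prop
  by_cases ha : φ p ≤ 0
  · refine ⟨p, hH0 p hpH, ?_, ?_⟩
    · simp only [φ, hpp, hp] at ha
      rw [hp]; linarith
    · rw [hpp, hp]; linarith
  by_cases hb : 0 ≤ φ (-q)
  · refine ⟨-q, hH0 _ hqH, ?_, ?_⟩
    · rw [inner_neg_left, hqq, norm_neg, hq]; linarith
    · simp only [φ, inner_neg_left, hqq, norm_neg, hq] at hb
      rw [inner_neg_left, norm_neg, hq]; linarith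
  obtain ⟨x, hx, hx0⟩ := hconv.isPreconnected.intermediate_value hqH hpH hφ.continuousOn
    (show (0:ℝ) ∈ Icc (φ (-q)) (φ p) from ⟨by linarith, by linarith⟩)
  have hx' : 0 < ⟪x, p - q⟫ := hx
  rw [inner_sub_right] at hx'
  simp only [φ] at hx0
  exact ⟨x, hH0 x hx, by linarith, by linarith⟩

lemma diff_pos {n : ℕ} {γ : ℝ → ℝ} (hγ : Measurable γ) {p q : Euc n} (hp : ‖p‖ = 1)
    (hq : ‖q‖ = 1) (hpq : p ≠ q) {D : Set ℝ} (hD : MeasurableSet D) (hD0 : D ⊆ Ioi 0)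
    (hDγ : ∀ r ∈ D, γ r ∈ Ioo (-1:ℝ) 1) (hpos : volume D ≠ 0) :
    volume ({y : Euc n | ‖y‖ ∈ D} ∩ (Fset γ p \ Fset γ q)) ≠ 0 := by
  set ν := (volume.restrict D).map γ with hν
  have hν0 : ν (Ioo (-1:ℝ) 1) ≠ 0 := by
    rw [hν, Measure.map_apply hγ measurableSet_Ioo,
      Measure.restrict_apply (hγ measurableSet_Ioo),
      inter_eq_self_of_subset_right (show D ⊆ γ ⁻¹' Ioo (-1:ℝ) 1 from fun r hr => hDγ r hr)]
    exact hpos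
  obtain ⟨c, hc, hcn⟩ := exists_mem_forall_mem_nhdsWithin_pos_measure hν0
  obtain ⟨ω, hω, h1, h2⟩ := exists_between_dir hp hq hpq hc.1 hc.2
  obtain ⟨a, ha1, ha2⟩ := exists_between h1
  obtain ⟨b, hb1, hb2⟩ := exists_between h2
  set A := γ ⁻¹' Ioo a b ∩ D with hA
  have hAm : MeasurableSet A := (hγ measurableSet_Ioo).inter hD
  have hApos : 0 < volume A := by
    have := hcn (Ioo a b) (mem_nhdsWithin_of_mem_nhds (Ioo_mem_nhds ha2 hb1))
    rwa [hν, Measure.map_apply hγ measurableSet_Ioo,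
      Measure.restrict_apply (hγ measurableSet_Ioo)] at this
  have hA0 : A ⊆ Ioi 0 := fun r hr => hD0 hr.2
  set S : Set (Euc n) := {x | ⟪x, q⟫ < a} ∩ {x | b < ⟪x, p⟫} with hS
  have hSo : IsOpen S := by
    have hc1 : Continuous fun x : Euc n => ⟪x, q⟫ := by fun_prop
    have hc2 : Continuous fun x : Euc n => ⟪x, p⟫ := by fun_prop
    exact (isOpen_lt hc1 continuous_const).inter (isOpen_lt continuous_const hc2)
  have hvol := polar A hAm hA0 S hSo.measurableSet
  have hne : volume (coneShell A S) ≠ 0 := by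
    rw [hvol]
    refine mul_ne_zero ?_ ?_
    · refine ((hSo.preimage continuous_subtype_val).measure_pos _ ⟨⟨ω, ?_⟩, ha1, hb2⟩).ne'
      exact mem_sphere_zero_iff_norm.2 hω
    · refine ((setLIntegral_pos_iff (by fun_prop)).2 ?_).ne'
      rw [inter_eq_self_of_subset_right]
      · exact hApos
      · intro r hr
        have hr0 : 0 < r := hA0 hr
        rw [Function.mem_support]
        exact (ENNReal.ofReal_pos.2 (by positivity)).ne'
  refine fun h0 => hne (measure_mono_null ?_ h0)
  rintro y ⟨hy0, ⟨hy1, hy2⟩, hy3, hy4⟩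
  have hy3' : ⟪hatv y, q⟫ < a := hy3
  have hy4' : b < ⟪hatv y, p⟫ := hy4
  have hy1' : a < γ ‖y‖ ∧ γ ‖y‖ < b := hy1
  exact ⟨hy2, ⟨hy0, by linarith⟩, fun h => by linarith [h.2]⟩

lemma image_Fset {n : ℕ} (R : Euc n ≃ₗᵢ[ℝ] Euc n) (γ : ℝ → ℝ) (p : Euc n) :
    R '' Fset γ p = Fset γ (R p) := by
  have hh : ∀ z : Euc n, hatv (R z) = R (hatv z) := fun z => by simp [hatv]
  ext y
  constructor
  · rintro ⟨z, ⟨hz0, hz⟩, rfl⟩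
    refine ⟨by simpa using hz0, ?_⟩
    rw [hh, R.norm_map, R.inner_map_map]; exact hz
  · rintro ⟨hy0, hy⟩
    obtain ⟨z, rfl⟩ := R.surjective y
    rw [hh, R.norm_map, R.inner_map_map] at hy
    exact ⟨z, ⟨by simpa using hy0, hy⟩, rfl⟩

lemma sphSymm_eq {n : ℕ} {α : ℝ → ℝ} (hα : ∀ r, α r ∈ Icc (0:ℝ) Real.pi) {p : Euc n}
    (hp : ‖p‖ = 1) : sphSymm n α p = Fset (fun r => Real.cos (α r)) p := by
  ext y
  refine and_congr_right fun hy => ?_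
  have := abs_le.1 (inner_hatv_le hy hp)
  exact (cos_lt_iff (hα _) this.1 this.2).symm

lemma sphDistrib_glue {n : ℕ} {v : ℝ → ℝ} {α : ℝ → ℝ} {p : Euc n} {rb : ℝ}
    (hα : ∀ᵐ r ∂(volume.restrict (Ioi (0:ℝ))),
      μH[(n : ℝ) - 1] (capSet p r (α r)) = ENNReal.ofReal (v r))
    (R : Euc n ≃ₗᵢ[ℝ] Euc n) :
    SphDistrib v ((sphSymm n α p ∩ ball 0 rb) ∪ R '' (sphSymm n α p \ ball 0 rb)) := by
  unfold SphDistrib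
  filter_upwards [hα, ae_restrict_mem measurableSet_Ioi] with r hr hr0
  have hr0' : 0 < r := hr0
  have hcap : sphSymm n α p ∩ sphere 0 r = capSet p r (α r) := by
    ext y
    constructor
    · rintro ⟨⟨h1, h2⟩, h3⟩
      refine ⟨h3, ?_⟩
      rwa [mem_sphere_zero_iff_norm.1 h3] at h2
    · rintro ⟨h3, h2⟩
      have hy := mem_sphere_zero_iff_norm.1 h3
      refine ⟨⟨norm_pos_iff.1 (hy ▸ hr0'), ?_⟩, h3⟩
      rwa [hy]
  rw [image_union_inter_ball]
  rw [← hr, ← hcap]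
  rcases lt_or_ge r rb with h | h
  · congr 1
    ext y
    constructor
    · rintro ⟨h1 | h1, h2⟩
      · exact ⟨h1.1, h2⟩
      · refine absurd ?_ h1.2
        rw [mem_ball_zero_iff, mem_sphere_zero_iff_norm.1 h2]; exact h
    · rintro ⟨h1, h2⟩
      refine ⟨Or.inl ⟨h1, ?_⟩, h2⟩
      rw [mem_ball_zero_iff, mem_sphere_zero_iff_norm.1 h2]; exact h
  · rw [← hausdorff_image R _ (sphSymm n α p ∩ sphere 0 r), image_inter R.injective,
      R.image_sphere, map_zero]
    congr 1
    ext y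
    constructor
    · rintro ⟨h1 | h1, h2⟩
      · have := h1.2
        rw [mem_ball_zero_iff, mem_sphere_zero_iff_norm.1 h2] at this
        exact absurd this (not_lt.2 h)
      · exact ⟨h1.1, h2⟩
    · rintro ⟨h1, h2⟩
      refine ⟨Or.inr ⟨h1, ?_⟩, h2⟩
      rw [mem_ball_zero_iff, mem_sphere_zero_iff_norm.1 h2]; exact not_lt.2 h

/-- **Proposition 8.1.** If `{0 < α_v^∧ ≤ α_v^∨ < π}` is disconnected by a point `r̄` with
`α_v^∧(r̄) = 0` or `α_v^∨(r̄) = π`, then for every `R ∈ O(n)` the set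
`(F_v ∩ B(r̄)) ∪ R(F_v \ B(r̄))` is spherically `v`-distributed with the same perimeter as
`F_v`; in particular rigidity fails. -/
theorem rigidity_fails_disconnected
    (n : ℕ) (hn : 2 ≤ n)
    (v : ℝ → ℝ) (hv_meas : Measurable v) (hv_nonneg : ∀ r ∈ Ioi (0:ℝ), 0 ≤ v r)
    (hv_le : ∀ᵐ r ∂(volume.restrict (Ioi (0:ℝ))),
      v r ≤ (n : ℝ) * omegaBall n * r ^ (n - 1))
    (α : ℝ → ℝ) (hα_meas : Measurable α) (hα_mem : ∀ r, α r ∈ Icc (0:ℝ) Real.pi)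
    (hα : ∀ᵐ r ∂(volume.restrict (Ioi (0:ℝ))),
      μH[(n : ℝ) - 1] (capSet (e1 n (by omega)) r (α r)) = ENNReal.ofReal (v r))
    (hF_perim : perim (sphSymm n α (e1 n (by omega))) univ < ⊤)
    (hF_vol : volume (sphSymm n α (e1 n (by omega))) < ⊤)
    (rb : ℝ) (hrb : 0 < rb)
    (hdeg : apInf α rb = 0 ∨ apSup α rb = Real.pi)
    (hne1 : (Ioo (0:ℝ) rb ∩ {r : ℝ | 0 < r ∧ 0 < apInf α r ∧ apInf α r ≤ apSup α r ∧ apSup α r < Real.pi}).Nonempty)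
    (hne2 : (Ioi rb ∩ {r : ℝ | 0 < r ∧ 0 < apInf α r ∧ apInf α r ≤ apSup α r ∧ apSup α r < Real.pi}).Nonempty) :
    (∀ R : Euc n ≃ₗᵢ[ℝ] Euc n,
      SphDistrib v (((sphSymm n α (e1 n (by omega))) ∩ ball (0 : Euc n) rb) ∪ (R '' ((sphSymm n α (e1 n (by omega))) \ ball (0 : Euc n) rb))) ∧
        perim (((sphSymm n α (e1 n (by omega))) ∩ ball (0 : Euc n) rb) ∪ (R '' ((sphSymm n α (e1 n (by omega))) \ ball (0 : Euc n) rb))) univ = perim (sphSymm n α (e1 n (by omega))) univ) ∧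
    ¬ ∀ E : Set (Euc n), MeasurableSet E → SphDistrib v E →
        perim E univ = perim (sphSymm n α (e1 n (by omega))) univ →
        ∃ R : Euc n ≃ₗᵢ[ℝ] Euc n, volume (symmDiff E (R '' (sphSymm n α (e1 n (by omega))))) = 0 := by
  set p := e1 n (by omega) with hp
  have hp1 : ‖p‖ = 1 := norm_e1 _
  set γ : ℝ → ℝ := fun r => Real.cos (α r) with hγ
  have hγm : Measurable γ := Real.measurable_cos.comp hα_meas
  have hFeq : sphSymm n α p = Fset γ p := sphSymm_eq hα_mem hp1
  have hfin : μH[(n:ℝ) - 1] (essBoundary (Fset γ p)) < ⊤ := by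
    rw [← hFeq]
    have := hF_perim
    rwa [perim, inter_univ] at this
  have main : ∀ R : Euc n ≃ₗᵢ[ℝ] Euc n,
      SphDistrib v ((sphSymm n α p ∩ ball (0 : Euc n) rb) ∪
        (R '' (sphSymm n α p \ ball (0 : Euc n) rb))) ∧
      perim ((sphSymm n α p ∩ ball (0 : Euc n) rb) ∪
        (R '' (sphSymm n α p \ ball (0 : Euc n) rb))) univ = perim (sphSymm n α p) univ := by
    intro R
    refine ⟨sphDistrib_glue hα R, ?_⟩
    obtain ⟨I, hI, q, hside⟩ := side_exists hn _ hα_meas hα_mem hγ hfin hrb hdeg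
    rw [perim, perim, inter_univ, inter_univ, hFeq]
    exact perim_eq hn hrb hI hside R
  refine ⟨main, fun hrig => ?_⟩
  have hFm : MeasurableSet (sphSymm n α p) := by rw [hFeq]; exact measurableSet_Fset hγm p
  set R0 : Euc n ≃ₗᵢ[ℝ] Euc n := LinearIsometryEquiv.neg ℝ with hR0
  have hR0p : R0 p = -p := rfl
  have hEeq : R0 '' (sphSymm n α p \ ball (0 : Euc n) rb) = Fset γ (-p) \ ball 0 rb := by
    rw [image_union_inter_ball, hFeq, image_Fset, hR0p]
  obtain ⟨R, hR⟩ := hrig _ (by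
    rw [hEeq]
    exact (hFm.inter measurableSet_ball).union
      ((measurableSet_Fset hγm _).diff measurableSet_ball)) (main R0).1 (main R0).2
  rw [hEeq, hFeq, image_Fset] at hR
  have hq1 : ‖R p‖ = 1 := by rw [R.norm_map, hp1]
  have hγI : ∀ r, 0 < α r ∧ α r < Real.pi → γ r ∈ Ioo (-1:ℝ) 1 := by
    rintro r ⟨h1, h2⟩
    constructor
    · have := Real.strictAntiOn_cos (hα_mem r) ⟨Real.pi_pos.le, le_rfl⟩ h2
      rwa [Real.cos_pi] at this
    · have := Real.strictAntiOn_cos ⟨le_rfl, Real.pi_pos.le⟩ (hα_mem r) h1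
      rwa [Real.cos_zero] at this
  have hDm : MeasurableSet {r | 0 < α r ∧ α r < Real.pi} :=
    (measurableSet_lt measurable_const hα_meas).inter (measurableSet_lt hα_meas measurable_const)
  have hqa : p = R p := by
    by_contra hne
    obtain ⟨r1, hr1, _, h1, _, h2⟩ := hne1
    have hpos := pos_radii hα_mem (isOpen_Ioo.mem_nhds hr1) h1 h2
    refine diff_pos hγm hp1 hq1 hne (measurableSet_Ioo.inter hDm) (fun r hr => hr.1.1)
      (fun r hr => hγI r hr.2) hpos (measure_mono_null ?_ hR)
    rintro y ⟨hy1, hy2, hy3⟩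
    exact Or.inl ⟨Or.inl ⟨hy2, mem_ball_zero_iff.2 hy1.1.2⟩, hy3⟩
  have hqb : -p = R p := by
    by_contra hne
    obtain ⟨r1, hr1, _, h1, _, h2⟩ := hne2
    have hpos := pos_radii hα_mem (isOpen_Ioi.mem_nhds hr1) h1 h2
    refine diff_pos hγm (by rw [norm_neg, hp1]) hq1 hne (measurableSet_Ioi.inter hDm)
      (fun r hr => hrb.trans hr.1)
      (fun r hr => hγI r hr.2) hpos (measure_mono_null ?_ hR)
    rintro y ⟨hy1, hy2, hy3⟩
    refine Or.inl ⟨Or.inr ⟨hy2, fun h => ?_⟩, hy3⟩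
    have h5 : rb < ‖y‖ := hy1.1
    exact absurd (mem_ball_zero_iff.1 h) (not_lt.2 h5.le)
  have hpp : p = -p := hqa.trans hqb.symm
  have h6 : (⟪p, p⟫ : ℝ) = -⟪p, p⟫ := by
    conv_lhs => rw [show (⟪p, p⟫ : ℝ) = ⟪-p, p⟫ from congrArg (fun z => (⟪z, p⟫ : ℝ)) hpp]
    rw [inner_neg_left]
  rw [real_inner_self_eq_norm_sq, hp1] at h6
  norm_num at h6
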